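/- arXiv:1601.00098 — 11 statements merged into one kernel-verified Lean document; each statement's English description precedes it below -/
import Mathlib

section
/- Let n, m be positive integers and h > 0. Let f : ℝⁿ → ℝⁿ be continuous with ‖f(z)‖ ≤ M_f‖z‖ for all z ∈ ℝⁿ, let B₁ : ℝⁿ → ℝ^{n×m} be continuous with ‖B₁(z)‖ ≤ M_{B₁} for all z, and let B_int : [-h,0] × ℝⁿ → ℝ^{n×m} be continuous with ‖B_int(θ,z)‖ ≤ M_int for all θ ∈ [-h,0] and z ∈ ℝⁿ. Let φ : [-h,0] → ℝᵐ be continuous, let x ∈ ℝⁿ, and let ξ : [0,h] → ℝⁿ be a C¹ solution of the predictor ODE with ξ(0) = x. Then for every s ∈ [0,h], ‖ξ(s)‖² ≤ ρ²(‖x‖² + ‖φ‖²), where ρ = √2 · e^{M_f h} · max{1, √h·(M_{B₁} + h·M_int)}. -/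
open Real Set

/-- Grönwall inequality with a continuous nonnegative forcing term. -/
theorem norm_le_exp_mul_add_integral_of_norm_deriv_right_le
    {E : Type*} [NormedAddCommGroup E] [NormedSpace ℝ E]
    {u u' : ℝ → E} {g : ℝ → ℝ} {K a b : ℝ} (hK : 0 ≤ K) (hg : Continuous g) (hg0 : ∀ t, 0 ≤ g t)
    (hu : ContinuousOn u (Icc a b))
    (hu' : ∀ t ∈ Ico a b, HasDerivWithinAt u (u' t) (Ici t) t)
    (bound : ∀ t ∈ Ico a b, ‖u' t‖ ≤ K * ‖u t‖ + g t) {t : ℝ} (ht : t ∈ Icc a b) :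
    ‖u t‖ ≤ exp (K * (t - a)) * (‖u a‖ + ∫ r in a..t, g r) := by
  have key : ∀ ε > 0, ‖u t‖ ≤ exp (K * (t - a)) * (‖u a‖ + (∫ r in a..t, g r) + ε * (t - a)) := by
    intro ε hε
    have hB : ∀ y, HasDerivAt
        (fun y => exp (K * (y - a)) * (‖u a‖ + (∫ r in a..y, g r) + ε * (y - a)))
        (exp (K * (y - a)) * (K * 1) * (‖u a‖ + (∫ r in a..y, g r) + ε * (y - a)) +
          exp (K * (y - a)) * (g y + ε * 1)) y := by
      intro y
      have hsub := (hasDerivAt_id y).sub_const a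
      have hint := intervalIntegral.integral_hasDerivAt_right (hg.intervalIntegrable a y)
        (hg.stronglyMeasurableAtFilter _ _) hg.continuousAt
      exact (hsub.const_mul K).exp.mul ((hint.const_add ‖u a‖).add (hsub.const_mul ε))
    refine image_norm_le_of_norm_deriv_right_lt_deriv_boundary hu hu' (by simp) hB ?_ ht
    intro y hy hyB
    have hexp : 1 ≤ exp (K * (y - a)) := one_le_exp (mul_nonneg hK (sub_nonneg.2 hy.1))
    have := bound y hy
    rw [hyB] at this
    nlinarith [mul_nonneg (sub_nonneg.2 hexp) (add_nonneg (hg0 y) hε.le)]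
  refine ge_of_tendsto (x := nhdsWithin (0 : ℝ) (Ioi 0))
    (f := fun ε => exp (K * (t - a)) * (‖u a‖ + (∫ r in a..t, g r) + ε * (t - a))) ?_
    (Filter.eventually_of_mem self_mem_nhdsWithin key)
  have hcont : Continuous fun ε : ℝ =>
      exp (K * (t - a)) * (‖u a‖ + (∫ r in a..t, g r) + ε * (t - a)) := by fun_prop
  simpa using (hcont.tendsto 0).mono_left nhdsWithin_le_nhds

/-- Cauchy–Schwarz inequality against the constant function one on an interval. -/
theorem sq_intervalIntegral_le_mul_intervalIntegral_sq {g : ℝ → ℝ} (hg : Continuous g) {a b : ℝ}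
    (hab : a < b) : (∫ t in a..b, g t) ^ 2 ≤ (b - a) * ∫ t in a..b, g t ^ 2 := by
  set I := ∫ t in a..b, g t with hI
  have hpos : 0 < b - a := sub_pos.2 hab
  have hnonneg : 0 ≤ ∫ t in a..b, ((b - a) * g t - I) ^ 2 :=
    intervalIntegral.integral_nonneg hab.le fun _ _ => sq_nonneg _
  have hexpand : ∫ t in a..b, ((b - a) * g t - I) ^ 2 =
      (b - a) * ((b - a) * (∫ t in a..b, g t ^ 2) - I ^ 2) := by
    have hfun : (fun t => ((b - a) * g t - I) ^ 2) =
        fun t => (b - a) ^ 2 * g t ^ 2 - 2 * (b - a) * I * g t + I ^ 2 := by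
      funext t; ring
    rw [hfun, intervalIntegral.integral_add, intervalIntegral.integral_sub,
      intervalIntegral.integral_const_mul, intervalIntegral.integral_const_mul,
      intervalIntegral.integral_const, ← hI, smul_eq_mul]
    · ring
    all_goals exact Continuous.intervalIntegrable (by fun_prop) _ _
  rw [hexpand] at hnonneg
  linarith [nonneg_of_mul_nonneg_right hnonneg hpos]

/-- Young inequality step turning a linear bound into a bound on squares. -/
theorem sq_exp_mul_add_le {E X C P h J : ℝ} (hh : 0 ≤ h) (hC : 0 ≤ C) (hJ : 0 ≤ J)
    (hP : P ^ 2 ≤ h * J) :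
    (E * (X + C * P)) ^ 2 ≤ (√2 * E * max 1 (√h * C)) ^ 2 * (X ^ 2 + J) := by
  set M := max 1 (√h * C)
  have hM1 : 1 ≤ M ^ 2 := one_le_pow₀ (le_max_left _ _)
  have hM2 : h * C ^ 2 ≤ M ^ 2 := by
    calc h * C ^ 2 = (√h * C) ^ 2 := by rw [mul_pow, sq_sqrt hh]
      _ ≤ M ^ 2 := pow_le_pow_left₀ (by positivity) (le_max_right _ _) 2
  have hCP : (C * P) ^ 2 ≤ M ^ 2 * J := by
    calc (C * P) ^ 2 = C ^ 2 * P ^ 2 := mul_pow _ _ _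
      _ ≤ C ^ 2 * (h * J) := by gcongr
      _ = h * C ^ 2 * J := by ring
      _ ≤ M ^ 2 * J := by gcongr
  have hX : X ^ 2 ≤ M ^ 2 * X ^ 2 := le_mul_of_one_le_left (sq_nonneg X) hM1
  calc (E * (X + C * P)) ^ 2 = E ^ 2 * (X + C * P) ^ 2 := mul_pow _ _ _
    _ ≤ E ^ 2 * (2 * (M ^ 2 * X ^ 2 + M ^ 2 * J)) := by
        gcongr
        linarith [add_sq_le (a := X) (b := C * P)]
    _ = (√2 * E * M) ^ 2 * (X ^ 2 + J) := by
        rw [mul_pow, mul_pow, sq_sqrt zero_le_two]; ring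

/-- **Forward a priori estimate of Lemma 1.**  For the predictor ODE
`ξ'(s) = f(ξ(s)) + B₁(ξ(s))φ(s-h) + ∫_{-h}^{-s} B_int(θ, ξ(s)) φ(s+θ) dθ`, `ξ(0) = x`,
with `f` linearly bounded and `B₁`, `B_int` uniformly bounded, one has
`‖ξ(s)‖² ≤ ρ²(‖x‖² + ‖φ‖²)` with `ρ = √2 e^{M_f h} max{1, √h (M_{B₁} + h M_int)}`. -/
theorem predictor_forward_estimate
    (n m : ℕ) (hn : 0 < n) (hm : 0 < m)
    (h : ℝ) (hh : 0 < h)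
    (Mf MB1 Mint : ℝ)
    (f : EuclideanSpace ℝ (Fin n) → EuclideanSpace ℝ (Fin n))
    (hf_cont : Continuous f)
    (hf_bound : ∀ z, ‖f z‖ ≤ Mf * ‖z‖)
    (B1 : EuclideanSpace ℝ (Fin n) → (EuclideanSpace ℝ (Fin m) →L[ℝ] EuclideanSpace ℝ (Fin n)))
    (hB1_cont : Continuous B1)
    (hB1_bound : ∀ z, ‖B1 z‖ ≤ MB1)
    (Bint : ℝ → EuclideanSpace ℝ (Fin n) →
      (EuclideanSpace ℝ (Fin m) →L[ℝ] EuclideanSpace ℝ (Fin n)))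
    (hBint_cont : ContinuousOn (fun p : ℝ × EuclideanSpace ℝ (Fin n) => Bint p.1 p.2)
      (Icc (-h) 0 ×ˢ univ))
    (hBint_bound : ∀ θ ∈ Icc (-h) 0, ∀ z, ‖Bint θ z‖ ≤ Mint)
    (φ : ℝ → EuclideanSpace ℝ (Fin m)) (hφ_cont : Continuous φ)
    (x : EuclideanSpace ℝ (Fin n))
    (ξ : ℝ → EuclideanSpace ℝ (Fin n))
    (hξ0 : ξ 0 = x)
    (hξ : ∀ s ∈ Icc 0 h, HasDerivWithinAt ξ
      (f (ξ s) + (B1 (ξ s)) (φ (s - h)) +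
        ∫ θ in (-h)..(-s), (Bint θ (ξ s)) (φ (s + θ))) (Icc 0 h) s)
    (hξC1 : ContDiffOn ℝ 1 ξ (Icc 0 h)) :
    ∀ s ∈ Icc 0 h,
      ‖ξ s‖ ^ 2 ≤
        (Real.sqrt 2 * Real.exp (Mf * h) * max 1 (Real.sqrt h * (MB1 + h * Mint))) ^ 2 *
          (‖x‖ ^ 2 + ∫ θ in (-h)..0, ‖φ θ‖ ^ 2) := by
  have hMf : 0 ≤ Mf := by
    have := (norm_nonneg _).trans (hf_bound (EuclideanSpace.single ⟨0, hn⟩ 1))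
    simpa using this
  have hMB1 : 0 ≤ MB1 := (norm_nonneg _).trans (hB1_bound 0)
  have hMint : 0 ≤ Mint := (norm_nonneg _).trans (hBint_bound 0 ⟨by linarith, le_rfl⟩ 0)
  have hφn : Continuous fun θ => ‖φ θ‖ := hφ_cont.norm
  set P := ∫ θ in (-h)..0, ‖φ θ‖ with hP
  have hP0 : 0 ≤ P := intervalIntegral.integral_nonneg (by linarith) fun _ _ => norm_nonneg _
  have hsubP : ∀ a b, -h ≤ a → a ≤ b → b ≤ 0 → ∫ θ in a..b, ‖φ θ‖ ≤ P := fun a b ha hab hb =>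
    intervalIntegral.integral_mono_interval ha hab hb
      (Filter.Eventually.of_forall fun _ => norm_nonneg _) (hφn.intervalIntegrable _ _)
  intro s hs
  have hgron := norm_le_exp_mul_add_integral_of_norm_deriv_right_le hMf
    (g := fun r => MB1 * ‖φ (r - h)‖ + Mint * P) (by fun_prop) (fun _ => by positivity)
    (fun t ht => (hξ t ht).continuousWithinAt)
    (fun t ht => (hξ t (Ico_subset_Icc_self ht)).mono_of_mem_nhdsWithin
      (Icc_mem_nhdsGE_of_mem ht)) ?_ hs
  · have hforce : ∫ r in (0 : ℝ)..s, (MB1 * ‖φ (r - h)‖ + Mint * P) ≤ (MB1 + h * Mint) * P := by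
      rw [intervalIntegral.integral_add (Continuous.intervalIntegrable (by fun_prop) _ _)
        (Continuous.intervalIntegrable (by fun_prop) _ _), intervalIntegral.integral_const_mul,
        intervalIntegral.integral_const,
        intervalIntegral.integral_comp_sub_right (fun θ => ‖φ θ‖) h, smul_eq_mul]
      have h1 := mul_le_mul_of_nonneg_left
        (hsubP (0 - h) (s - h) (by linarith) (by linarith [hs.1]) (by linarith [hs.2])) hMB1
      have h2 := mul_le_mul_of_nonneg_right hs.2 (mul_nonneg hMint hP0)
      linarith
    have hlin : ‖ξ s‖ ≤ exp (Mf * h) * (‖x‖ + (MB1 + h * Mint) * P) := by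
      rw [hξ0] at hgron
      have hle : exp (Mf * (s - 0)) ≤ exp (Mf * h) := by
        gcongr
        linarith [hs.2]
      exact hgron.trans ((mul_le_mul_of_nonneg_left (by linarith) (exp_pos _).le).trans
        (mul_le_mul_of_nonneg_right hle (by positivity)))
    have hCS : P ^ 2 ≤ h * ∫ θ in (-h)..0, ‖φ θ‖ ^ 2 := by
      simpa using sq_intervalIntegral_le_mul_intervalIntegral_sq hφn (neg_neg_of_pos hh)
    exact (pow_le_pow_left₀ (norm_nonneg _) hlin 2).trans
      (sq_exp_mul_add_le hh.le (by positivity)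
        (intervalIntegral.integral_nonneg (by linarith) fun _ _ => sq_nonneg _) hCS)
  · intro t ht
    have hdelay : ‖B1 (ξ t) (φ (t - h))‖ ≤ MB1 * ‖φ (t - h)‖ :=
      (B1 (ξ t)).le_of_opNorm_le (hB1_bound _) _
    have hdist : ‖∫ θ in (-h)..(-t), Bint θ (ξ t) (φ (t + θ))‖ ≤ Mint * P := by
      calc _ ≤ ∫ θ in (-h)..(-t), Mint * ‖φ (t + θ)‖ := by
            refine intervalIntegral.norm_integral_le_of_norm_le (by linarith [ht.2])
              (Filter.Eventually.of_forall fun θ hθ => ?_)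
              (Continuous.intervalIntegrable (by fun_prop) _ _)
            exact (Bint θ (ξ t)).le_of_opNorm_le
              (hBint_bound θ ⟨hθ.1.le, by linarith [hθ.2, ht.1]⟩ _) _
        _ = Mint * ∫ θ in (t + -h)..(t + -t), ‖φ θ‖ := by
            rw [intervalIntegral.integral_const_mul,
              intervalIntegral.integral_comp_add_left (fun θ => ‖φ θ‖) t]
        _ ≤ Mint * P := by
            gcongr
            exact hsubP _ _ (by linarith [ht.1]) (by linarith [ht.2]) (by linarith)
    have := norm_add₃_le (a := f (ξ t)) (b := B1 (ξ t) (φ (t - h)))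
      (c := ∫ θ in (-h)..(-t), Bint θ (ξ t) (φ (t + θ)))
    linarith [hf_bound (ξ t)]
end

section
/- Let n, m be positive integers and h > 0. Let f : ℝⁿ → ℝⁿ be C¹ with Jacobian A(z) ∈ ℝ^{n×n}; let B₀, B₁ : ℝⁿ → ℝ^{n×m} be continuous, with B₁ C¹ and, for i = 1,…,m, let 𝓑₁ⁱ(z) ∈ ℝ^{n×n} denote the Jacobian of the i-th column of B₁ at z; let B_int : [-h,0] × ℝⁿ → ℝ^{n×m} be continuous and C¹ in its second argument, with 𝓑_intⁱ(θ,z) ∈ ℝ^{n×n} the Jacobian in z of the i-th column of B_int(θ,·). Let u : ℝ → ℝᵐ be continuous and let x : [0,∞) → ℝⁿ be C¹ satisfying, for all t ≥ 0, ẋ(t) = f(x(t)) + B₀(x(t))u(t) + B₁(x(t))u(t-h) + ∫_{-h}^0 B_int(θ, x(t)) u(t+θ) dθ. Suppose ξ : [0,∞) × [0,h] → ℝⁿ is such that for each t ≥ 0 the map s ↦ ξ(t,s) is the C¹ solution of ∂ξ/∂s(t,s) = f(ξ(t,s)) + B₁(ξ(t,s)) u(t+s-h) + ∫_{-h}^{-s}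 B_int(θ, ξ(t,s)) u(t+s+θ) dθ with ξ(t,0) = x(t), and suppose β : [0,∞) × [0,h] → ℝ^{n×m} is such that for each t ≥ 0 the map s ↦ β(t,s) is the C¹ solution of ∂β/∂s(t,s) = Ã(t,s)β(t,s) + B_int(-s, ξ(t,s)) with β(t,0) = B₀(x(t)), where Ã(t,s) = A(ξ(t,s)) + Σ_{i=1}^m 𝓑₁ⁱ(ξ(t,s)) u_i(t+s-h) + Σ_{i=1}^m ∫_{-h}^{-s} 𝓑_intⁱ(θ, ξ(t,s)) u_i(t+s+θ) dθ. Then the function y(t) := ξ(t,h) is differentiable in t and satisfies ẏ(t) = f(y(t)) + (B₁(y(t)) + β(t,h)) u(t) for all t ≥ 0. -/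
open Real Set

open Filter Topology

section ParametricFlow

variable {E : Type*} [NormedAddCommGroup E] [NormedSpace ℝ E]

/-- A family of vector fields that is `C¹` in the parameter and the state is linearized at
the same rate along a whole compact piece of trajectory. -/
lemma exists_uniform_linearization {G Gt : ℝ → ℝ → E → E} {Gz : ℝ → ℝ → E → E →L[ℝ] E}
    (hGt : ∀ t r z, HasDerivAt (fun τ => G τ r z) (Gt t r z) t)
    (hGz : ∀ t r z, HasFDerivAt (G t r) (Gz t r z) z)
    (hGt_cont : Continuous fun p : ℝ × ℝ × E => Gt p.1 p.2.1 p.2.2)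
    (hGz_cont : Continuous fun p : ℝ × ℝ × E => Gz p.1 p.2.1 p.2.2)
    {t₀ a₀ b₀ : ℝ} {φ : ℝ → E} (hφ : ContinuousOn φ (Icc a₀ b₀)) {ε : ℝ} (hε : 0 < ε) :
    ∃ ρ > 0, ∀ r ∈ Icc a₀ b₀, ∀ t, |t - t₀| < ρ → ∀ z, ‖z - φ r‖ < ρ →
      ‖G t r z - G t₀ r (φ r) - ((t - t₀) • Gt t₀ r (φ r) + Gz t₀ r (φ r) (z - φ r))‖ ≤
        ε * (|t - t₀| + ‖z - φ r‖) := by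
  set K : Set (ℝ × ℝ × E) := (fun r => (t₀, r, φ r)) '' Icc a₀ b₀ with hK
  have hKc : IsCompact K := isCompact_Icc.image_of_continuousOn (by fun_prop)
  have h1 := hKc.uniformContinuousAt_of_continuousAt _
    (fun p _ => hGt_cont.continuousAt (x := p)) (Metric.dist_mem_uniformity hε)
  have h2 := hKc.uniformContinuousAt_of_continuousAt _
    (fun p _ => hGz_cont.continuousAt (x := p)) (Metric.dist_mem_uniformity hε)
  obtain ⟨ρ, hρ, hsub⟩ := Metric.mem_uniformity_dist.1 (inter_mem h1 h2)
  have key : ∀ r ∈ Icc a₀ b₀, ∀ t, |t - t₀| < ρ → ∀ z, ‖z - φ r‖ < ρ →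
      ‖Gt t r z - Gt t₀ r (φ r)‖ ≤ ε ∧ ‖Gz t r z - Gz t₀ r (φ r)‖ ≤ ε := by
    intro r hr t ht z hz
    have hd : dist (t₀, r, φ r) (t, r, z) < ρ := by
      rw [Prod.dist_eq, Prod.dist_eq, dist_comm t₀, dist_comm (φ r), Real.dist_eq, dist_eq_norm z]
      simp [ht, hz]
    have hm : (t₀, r, φ r) ∈ K := ⟨r, hr, rfl⟩
    obtain ⟨k1, k2⟩ := hsub hd
    have k1 := k1 hm
    have k2 := k2 hm
    simp only [mem_ofPred_eq] at k1 k2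
    rw [dist_comm, dist_eq_norm] at k1 k2
    exact ⟨k1.le, k2.le⟩
  refine ⟨ρ, hρ, fun r hr t ht z hz => ?_⟩
  have e1 : ‖G t r z - G t₀ r z - (t - t₀) • Gt t₀ r (φ r)‖ ≤ ε * |t - t₀| := by
    have := (convex_ball t₀ ρ).norm_image_sub_le_of_norm_hasDerivWithin_le
      (f := fun τ => G τ r z - τ • Gt t₀ r (φ r)) (f' := fun τ => Gt τ r z - Gt t₀ r (φ r))
      (C := ε) (x := t₀) (y := t)
      (fun τ _ => ((hGt τ r z).sub
        ((hasDerivAt_id τ).smul_const _)).hasDerivWithinAt.congr_deriv (by simp))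
      (fun τ hτ => (key r hr τ (by simpa [Real.dist_eq] using hτ) z hz).1)
      (Metric.mem_ball_self hρ) (by simpa [Real.dist_eq] using ht)
    rw [Real.norm_eq_abs] at this
    convert this using 2
    rw [sub_smul]; abel
  have e2 : ‖G t₀ r z - G t₀ r (φ r) - Gz t₀ r (φ r) (z - φ r)‖ ≤ ε * ‖z - φ r‖ :=
    (convex_ball (φ r) ρ).norm_image_sub_le_of_norm_hasFDerivWithin_le'
      (fun w _ => (hGz t₀ r w).hasFDerivWithinAt)
      (fun w hw => (key r hr t₀ (by simpa using hρ) w (by simpa [dist_eq_norm] using hw)).2)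
      (Metric.mem_ball_self hρ) (by simpa [dist_eq_norm] using hz)
  calc _ = ‖(G t r z - G t₀ r z - (t - t₀) • Gt t₀ r (φ r)) +
        (G t₀ r z - G t₀ r (φ r) - Gz t₀ r (φ r) (z - φ r))‖ := by congr 1; abel
    _ ≤ _ := (norm_add_le _ _).trans (by linarith)

/-- Trajectories for a nearby parameter that start close to first order stay close to first
order, with the solution `δ` of the linearized equation as first-order term. -/
lemma exists_first_order_bound {G Gt : ℝ → ℝ → E → E} {Gz : ℝ → ℝ → E → E →L[ℝ] E}
    (hGt : ∀ t r z, HasDerivAt (fun τ => G τ r z) (Gt t r z) t)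
    (hGz : ∀ t r z, HasFDerivAt (G t r) (Gz t r z) z)
    (hGt_cont : Continuous fun p : ℝ × ℝ × E => Gt p.1 p.2.1 p.2.2)
    (hGz_cont : Continuous fun p : ℝ × ℝ × E => Gz p.1 p.2.1 p.2.2)
    {t₀ a₀ b₀ : ℝ} {φ₀ δ : ℝ → E}
    (hφ₀ : ∀ r ∈ Icc a₀ b₀, HasDerivWithinAt φ₀ (G t₀ r (φ₀ r)) (Icc a₀ b₀) r)
    (hδ : ∀ r ∈ Icc a₀ b₀, HasDerivWithinAt δ
      (Gz t₀ r (φ₀ r) (δ r) + Gt t₀ r (φ₀ r)) (Icc a₀ b₀) r) :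
    ∃ C > 0, ∀ ε > 0, ∃ ρ > 0, ∀ t, |t - t₀| < ρ → t ≠ t₀ → ∀ (a b : ℝ) (φ : ℝ → E),
      a₀ ≤ a → b ≤ b₀ → (∀ r ∈ Icc a b, HasDerivWithinAt φ (G t r (φ r)) (Icc a b) r) →
      ‖φ a - φ₀ a - (t - t₀) • δ a‖ ≤ ε * |t - t₀| →
      ∀ r ∈ Icc a b, ‖φ r - φ₀ r - (t - t₀) • δ r‖ ≤ C * ε * |t - t₀| := by
  have hφ₀c : ContinuousOn φ₀ (Icc a₀ b₀) := fun r hr => (hφ₀ r hr).continuousWithinAt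
  have hδc : ContinuousOn δ (Icc a₀ b₀) := fun r hr => (hδ r hr).continuousWithinAt
  obtain ⟨K', hK'⟩ := isCompact_Icc.exists_bound_of_continuousOn
    (f := fun r => Gz t₀ r (φ₀ r)) (s := Icc a₀ b₀)
    (hGz_cont.comp_continuousOn (f := fun r => (t₀, r, φ₀ r)) (by fun_prop))
  obtain ⟨M', hM'⟩ := isCompact_Icc.exists_bound_of_continuousOn hδc
  set K := max K' 0
  set M := max M' 0
  have hK0 : 0 ≤ K := le_max_right _ _
  have hM0 : 0 ≤ M := le_max_right _ _
  have hK : ∀ r ∈ Icc a₀ b₀, ‖Gz t₀ r (φ₀ r)‖ ≤ K := fun r hr => (hK' r hr).trans (le_max_left _ _)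
  have hM : ∀ r ∈ Icc a₀ b₀, ‖δ r‖ ≤ M := fun r hr => (hM' r hr).trans (le_max_left _ _)
  set C := Real.exp ((K + 2) * (b₀ - a₀)) with hC
  have hC0 : 0 < C := Real.exp_pos _
  refine ⟨C, hC0, fun ε hε => ?_⟩
  set ε₁ := min 1 (ε / (2 * (1 + M)))
  have hε₁ : 0 < ε₁ := lt_min one_pos (by positivity)
  have hε₁1 : ε₁ ≤ 1 := min_le_left _ _
  have hε₁M : ε₁ * (1 + M) ≤ ε / 2 := by
    have : ε₁ ≤ ε / (2 * (1 + M)) := min_le_right _ _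
    calc ε₁ * (1 + M) ≤ ε / (2 * (1 + M)) * (1 + M) := by gcongr
      _ = ε / 2 := by field_simp
  obtain ⟨ρ₁, hρ₁, hlin⟩ := exists_uniform_linearization hGt hGz hGt_cont hGz_cont (t₀ := t₀)
    hφ₀c hε₁
  have hden : 0 < M + C * ε + 1 := by positivity
  refine ⟨min ρ₁ (ρ₁ / (M + C * ε + 1)), lt_min hρ₁ (by positivity), ?_⟩
  intro t ht htne a b φ ha hb hφ hinit r hr
  have hτ : 0 < |t - t₀| := abs_pos.2 (sub_ne_zero.2 htne)
  set τ := |t - t₀| with hτdef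
  have htρ : τ < ρ₁ := ht.trans_le (min_le_left _ _)
  have htρ' : τ * (M + C * ε + 1) < ρ₁ := by
    rw [← lt_div_iff₀ hden]; exact ht.trans_le (min_le_right _ _)
  have hsub : Icc a b ⊆ Icc a₀ b₀ := Icc_subset_Icc ha hb
  set B : ℝ → ℝ := fun r => ε * τ * Real.exp ((K + 2) * (r - a)) with hB
  have hBC : ∀ r ∈ Icc a b, B r ≤ C * ε * τ := by
    intro r hr
    have : Real.exp ((K + 2) * (r - a)) ≤ C := by
      apply Real.exp_le_exp.2
      have := (hr.2.trans hb)
      gcongr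
    calc B r ≤ ε * τ * C := by simp only [hB]; gcongr
      _ = _ := by ring
  have hBlow : ∀ r ∈ Icc a b, ε * τ ≤ B r := by
    intro r hr
    have : 1 ≤ Real.exp ((K + 2) * (r - a)) :=
      Real.one_le_exp (mul_nonneg (by linarith) (by linarith [hr.1]))
    simp only [hB]
    nlinarith [mul_pos hε hτ]
  have hw : ∀ r ∈ Icc a b, HasDerivWithinAt (fun r => φ r - φ₀ r - (t - t₀) • δ r)
      (G t r (φ r) - G t₀ r (φ₀ r) -
        (t - t₀) • (Gz t₀ r (φ₀ r) (δ r) + Gt t₀ r (φ₀ r))) (Icc a b) r := fun r hr =>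
    ((hφ r hr).sub ((hφ₀ r (hsub hr)).mono hsub)).sub
      (((hδ r (hsub hr)).mono hsub).const_smul _)
  refine (image_norm_le_of_norm_deriv_right_lt_deriv_boundary
    (f := fun r => φ r - φ₀ r - (t - t₀) • δ r) (B := B) (B' := fun r => (K + 2) * B r)
    (fun r hr => (hw r hr).continuousWithinAt)
    (fun r hr => (hw r (Ico_subset_Icc_self hr)).mono_of_mem_nhdsWithin
      (Icc_mem_nhdsGE_of_mem hr)) ?_ ?_ ?_ hr).trans (hBC r hr)
  · simpa [hB] using hinit
  · intro r
    have := ((((hasDerivAt_id r).sub_const a).const_mul (K + 2)).exp).const_mul (ε * τ)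
    refine this.congr_deriv ?_
    simp only [hB, id]; ring
  · intro r hr hwB
    have hr' := Ico_subset_Icc_self hr
    set w := φ r - φ₀ r - (t - t₀) • δ r with hwdef
    have hΔ : φ r - φ₀ r = (t - t₀) • δ r + w := by rw [hwdef]; abel
    have hΔn : ‖φ r - φ₀ r‖ ≤ τ * M + B r := by
      rw [hΔ, ← hwB]
      refine (norm_add_le _ _).trans ?_
      rw [norm_smul, Real.norm_eq_abs]
      have := hM r (hsub hr')
      gcongr
    have hBr := hBC r hr'
    have hBl := hBlow r hr'
    have hl := hlin r (hsub hr') t htρ (φ r) (by nlinarith)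
    have hB0 : 0 < B r := lt_of_lt_of_le (by positivity) hBl
    calc _ = ‖(G t r (φ r) - G t₀ r (φ₀ r) - ((t - t₀) • Gt t₀ r (φ₀ r) +
            Gz t₀ r (φ₀ r) (φ r - φ₀ r))) + Gz t₀ r (φ₀ r) w‖ := by
          rw [hΔ]; congr 1
          simp only [map_add, map_smul, smul_add]; abel
      _ ≤ ε₁ * (τ + (τ * M + B r)) + K * B r := by
          refine (norm_add_le _ _).trans (add_le_add (hl.trans ?_) ?_)
          · gcongr
          · rw [← hwB]
            exact ((Gz t₀ r (φ₀ r)).le_opNorm w).trans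
              (mul_le_mul_of_nonneg_right (hK r (hsub hr')) (norm_nonneg _))
      _ < (K + 2) * B r := by
          have h1 : ε₁ * (1 + M) * τ ≤ ε / 2 * τ := by gcongr
          have h2 : ε₁ * B r ≤ 1 * B r := by gcongr
          nlinarith [mul_pos hε hτ]

/-- Short trajectories near a point move with the velocity prescribed at that point. -/
lemma exists_short_time_bound {G : ℝ → ℝ → E → E}
    (hG : Continuous fun p : ℝ × ℝ × E => G p.1 p.2.1 p.2.2) (t₀ r₀ : ℝ) (z₀ : E)
    {ε : ℝ} (hε : 0 < ε) :
    ∃ ρ > 0, ∀ t, |t - t₀| < ρ → ∀ (a b : ℝ) (φ : ℝ → E), a ≤ b →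
      |a - r₀| < ρ → |b - r₀| < ρ → ‖φ a - z₀‖ < ρ →
      (∀ r ∈ Icc a b, HasDerivWithinAt φ (G t r (φ r)) (Icc a b) r) →
      ‖φ b - φ a - (b - a) • G t₀ r₀ z₀‖ ≤ ε * (b - a) := by
  obtain ⟨ρ₁, hρ₁, hclose⟩ := Metric.continuousAt_iff.1
    (hG.continuousAt (x := (t₀, r₀, z₀))) ε hε
  set F := G t₀ r₀ z₀ with hF
  have hden : 0 < 1 + 2 * (‖F‖ + ε) := by positivity
  refine ⟨ρ₁ / (1 + 2 * (‖F‖ + ε)), by positivity, ?_⟩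
  set ρ := ρ₁ / (1 + 2 * (‖F‖ + ε)) with hρdef
  have hρmul : ρ + 2 * ρ * (‖F‖ + ε) = ρ₁ := by rw [hρdef]; field_simp
  have hρ : 0 < ρ := by positivity
  have hρle : ρ ≤ ρ₁ := by nlinarith [mul_nonneg hρ.le (by positivity : 0 ≤ ‖F‖ + ε)]
  intro t ht a b φ hab ha hb hφa hφ
  have hw : ∀ r ∈ Icc a b, HasDerivWithinAt (fun r => φ r - φ a - (r - a) • F)
      (G t r (φ r) - F) (Icc a b) r := fun r hr =>
    (((hφ r hr).sub_const (φ a)).sub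
      ((((hasDerivAt_id r).sub_const a).hasDerivWithinAt).smul_const F)).congr_deriv (by simp)
  refine image_norm_le_of_norm_deriv_right_lt_deriv_boundary
    (f := fun r => φ r - φ a - (r - a) • F) (B := fun r => ε * (r - a)) (B' := fun _ => ε)
    (fun r hr => (hw r hr).continuousWithinAt)
    (fun r hr => (hw r (Ico_subset_Icc_self hr)).mono_of_mem_nhdsWithin
      (Icc_mem_nhdsGE_of_mem hr)) (by simp) ?_ ?_ (right_mem_Icc.2 hab)
  · intro r
    simpa using ((hasDerivAt_id r).sub_const a).const_mul ε
  · intro r hr hwB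
    rw [abs_lt] at ha hb
    have hra : 0 ≤ r - a := by linarith [hr.1]
    have hra' : r - a ≤ 2 * ρ := by linarith [hr.2]
    have hφr : ‖φ r - z₀‖ < ρ₁ := by
      calc ‖φ r - z₀‖ = ‖(φ r - φ a - (r - a) • F) + (r - a) • F + (φ a - z₀)‖ := by
            congr 1; abel
        _ ≤ ε * (r - a) + (r - a) * ‖F‖ + ‖φ a - z₀‖ := by
            refine (norm_add₃_le).trans ?_
            rw [hwB, norm_smul, Real.norm_of_nonneg hra]
        _ < ρ₁ := by nlinarith [mul_le_mul_of_nonneg_right hra' (by positivity : 0 ≤ ‖F‖ + ε)]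
    have hr₀ : |r - r₀| < ρ₁ := by rw [abs_lt]; constructor <;> linarith [hr.1, hr.2]
    have hd : dist (t, r, φ r) (t₀, r₀, z₀) < ρ₁ := by
      rw [Prod.dist_eq, Prod.dist_eq, Real.dist_eq, Real.dist_eq, dist_eq_norm]
      exact max_lt (ht.trans_le hρle) (max_lt hr₀ hφr)
    simpa [dist_eq_norm] using hclose hd

/-- The endpoint at time `t + h` of the trajectory started at time `t` is differentiable in `t`,
when both the vector field and the starting point depend on `t`. -/
lemma hasDerivWithinAt_moving_endpoint {G Gt : ℝ → ℝ → E → E} {Gz : ℝ → ℝ → E → E →L[ℝ] E}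
    (hG : Continuous fun p : ℝ × ℝ × E => G p.1 p.2.1 p.2.2)
    (hGt : ∀ t r z, HasDerivAt (fun τ => G τ r z) (Gt t r z) t)
    (hGz : ∀ t r z, HasFDerivAt (G t r) (Gz t r z) z)
    (hGt_cont : Continuous fun p : ℝ × ℝ × E => Gt p.1 p.2.1 p.2.2)
    (hGz_cont : Continuous fun p : ℝ × ℝ × E => Gz p.1 p.2.1 p.2.2)
    {h : ℝ} (hh : 0 < h) {S : Set ℝ} {η : ℝ → ℝ → E}
    (hη : ∀ t ∈ S, ∀ r ∈ Icc t (t + h),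
      HasDerivWithinAt (η t) (G t r (η t r)) (Icc t (t + h)) r)
    {t₀ : ℝ} (ht₀ : t₀ ∈ S) {δ : ℝ → E}
    (hδ : ∀ r ∈ Icc t₀ (t₀ + h), HasDerivWithinAt δ
      (Gz t₀ r (η t₀ r) (δ r) + Gt t₀ r (η t₀ r)) (Icc t₀ (t₀ + h)) r)
    (hstart : HasDerivWithinAt (fun t => η t t) (δ t₀ + G t₀ t₀ (η t₀ t₀)) S t₀) :
    HasDerivWithinAt (fun t => η t (t + h))
      (δ (t₀ + h) + G t₀ (t₀ + h) (η t₀ (t₀ + h))) S t₀ := by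
  obtain ⟨C, hC, hfence⟩ := exists_first_order_bound hGt hGz hGt_cont hGz_cont (hη t₀ ht₀) hδ
  have hδc : ContinuousOn δ (Icc t₀ (t₀ + h)) := fun r hr => (hδ r hr).continuousWithinAt
  have hη₀c : ContinuousOn (η t₀) (Icc t₀ (t₀ + h)) :=
    fun r hr => (hη t₀ ht₀ r hr).continuousWithinAt
  have hl : t₀ ∈ Icc t₀ (t₀ + h) := ⟨le_rfl, by linarith⟩
  have hr : t₀ + h ∈ Icc t₀ (t₀ + h) := ⟨by linarith, le_rfl⟩
  rw [hasDerivWithinAt_iff_isLittleO, Asymptotics.isLittleO_iff]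
  intro c hc
  set ε := c / (C + 2) with hεdef
  have hε : 0 < ε := by positivity
  have hεc : C * ε + 2 * ε = c := by rw [hεdef]; field_simp
  have hε3 : 0 < ε / 3 := by positivity
  obtain ⟨ρ₁, hρ₁, hshort₁⟩ := exists_short_time_bound hG t₀ t₀ (η t₀ t₀) hε3
  obtain ⟨ρ₂, hρ₂, hshort₂⟩ := exists_short_time_bound hG t₀ (t₀ + h) (η t₀ (t₀ + h)) hε
  obtain ⟨ρ₃, hρ₃, hfence⟩ := hfence ε hε
  obtain ⟨ρ₄, hρ₄, hδl⟩ := Metric.continuousWithinAt_iff.1 (hδc _ hl) (ε / 3) hε3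
  obtain ⟨ρ₅, hρ₅, hδr⟩ := Metric.continuousWithinAt_iff.1 (hδc _ hr) ε hε
  obtain ⟨ρ₆, hρ₆, hηr⟩ := Metric.continuousWithinAt_iff.1 (hη₀c _ hr) ρ₂ hρ₂
  have hsmall : ∀ {ρ : ℝ}, 0 < ρ → ∀ᶠ t in 𝓝[S] t₀, |t - t₀| < ρ := fun hρ =>
    mem_nhdsWithin_of_mem_nhds (Metric.ball_mem_nhds t₀ hρ)
  have hxclose : ∀ᶠ t in 𝓝[S] t₀, ‖η t t - η t₀ t₀‖ < ρ₁ := by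
    simpa [dist_eq_norm] using hstart.continuousWithinAt.eventually (Metric.ball_mem_nhds _ hρ₁)
  have hxlin := (hasDerivWithinAt_iff_isLittleO.1 hstart).def hε3
  have hρ₇ : 0 < ρ₂ / (C * ε + ‖δ (t₀ + h)‖ + 1) := by positivity
  filter_upwards [hsmall hρ₁, hsmall hρ₂, hsmall hρ₃, hsmall hρ₄, hsmall hρ₅, hsmall hρ₆,
    hsmall hρ₇, hsmall hh, hxclose, hxlin, self_mem_nhdsWithin]
    with t h₁ h₂ h₃ h₄ h₅ h₆ h₇ h₈ hxc hxl htS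
  rw [lt_div_iff₀ (by positivity)] at h₇
  rw [Real.norm_eq_abs] at hxl ⊢
  rcases lt_trichotomy t t₀ with hlt | rfl | hgt
  · have hτ : |t - t₀| = t₀ - t := by rw [abs_of_neg (by linarith)]; ring
    rw [hτ] at h₁ h₂ h₃ h₄ h₅ h₆ h₇ h₈ hxl ⊢
    have hsol : ∀ r ∈ Icc t₀ (t + h), HasDerivWithinAt (η t) (G t r (η t r)) (Icc t₀ (t + h)) r :=
      fun r hr => (hη t htS r ⟨hlt.le.trans hr.1, hr.2⟩).mono (Icc_subset_Icc hlt.le le_rfl)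
    have hA := hshort₁ t (by rwa [hτ]) t t₀ (η t) hlt.le (by rwa [hτ]) (by simpa) hxc
      fun r hr => (hη t htS r ⟨hr.1, by linarith [hr.2]⟩).mono
        (Icc_subset_Icc le_rfl (by linarith))
    have hW := hfence t (by rwa [hτ]) hlt.ne t₀ (t + h) (η t) le_rfl (by linarith) hsol (by
      rw [hτ]
      calc _ = ‖(η t t₀ - η t t - (t₀ - t) • G t₀ t₀ (η t₀ t₀)) +
              (η t t - η t₀ t₀ - (t - t₀) • (δ t₀ + G t₀ t₀ (η t₀ t₀)))‖ := by
            congr 1; module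
        _ ≤ _ := (norm_add_le _ _).trans (by nlinarith)) (t + h) ⟨by linarith, le_rfl⟩
    rw [hτ] at hW
    have hmem : t + h ∈ Icc t₀ (t₀ + h) := ⟨by linarith, by linarith⟩
    have hdist : dist (t + h) (t₀ + h) = t₀ - t := by rw [dist_add_right, Real.dist_eq, hτ]
    have hB := hshort₂ t₀ (by simpa) (t + h) (t₀ + h) (η t₀) (by linarith)
      (by rw [add_sub_add_right_eq_sub, hτ]; exact h₂) (by simpa)
      (by rw [← dist_eq_norm]; exact hηr hmem (by rwa [hdist]))
      fun r hr => (hη t₀ ht₀ r ⟨by linarith [hr.1], hr.2⟩).mono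
        (Icc_subset_Icc (by linarith) le_rfl)
    have hD := hδr hmem (by rwa [hdist])
    rw [dist_eq_norm] at hD
    have hD' : ‖(t - t₀) • (δ (t + h) - δ (t₀ + h))‖ ≤ (t₀ - t) * ε := by
      rw [norm_smul, Real.norm_eq_abs, hτ]
      exact mul_le_mul_of_nonneg_left hD.le (by linarith)
    calc _ = ‖(η t (t + h) - η t₀ (t + h) - (t - t₀) • δ (t + h)) +
            -(η t₀ (t₀ + h) - η t₀ (t + h) -
              (t₀ + h - (t + h)) • G t₀ (t₀ + h) (η t₀ (t₀ + h))) +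
            (t - t₀) • (δ (t + h) - δ (t₀ + h))‖ := by congr 1; module
      _ ≤ C * ε * (t₀ - t) + ε * (t₀ + h - (t + h)) + (t₀ - t) * ε := by
          refine norm_add₃_le.trans ?_
          rw [norm_neg]
          gcongr
      _ = _ := by rw [← hεc]; ring
  · simp
  · have hτ : |t - t₀| = t - t₀ := abs_of_pos (by linarith)
    rw [hτ] at h₁ h₂ h₃ h₄ h₅ h₆ h₇ h₈ hxl ⊢
    have hsol : ∀ r ∈ Icc t (t₀ + h), HasDerivWithinAt (η t) (G t r (η t r)) (Icc t (t₀ + h)) r :=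
      fun r hr => (hη t htS r ⟨hr.1, by linarith [hr.2]⟩).mono
        (Icc_subset_Icc le_rfl (by linarith))
    have hmem : t ∈ Icc t₀ (t₀ + h) := ⟨hgt.le, by linarith⟩
    have hA := hshort₁ t₀ (by simpa) t₀ t (η t₀) hgt.le (by simpa) (by rwa [hτ]) (by simpa)
      fun r hr => (hη t₀ ht₀ r ⟨hr.1, by linarith [hr.2]⟩).mono
        (Icc_subset_Icc le_rfl (by linarith))
    have hD := hδl hmem (by rwa [Real.dist_eq, hτ])
    rw [dist_eq_norm] at hD
    have hD' : ‖(t - t₀) • (δ t - δ t₀)‖ ≤ (t - t₀) * (ε / 3) := by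
      rw [norm_smul, Real.norm_eq_abs, hτ]
      exact mul_le_mul_of_nonneg_left hD.le (by linarith)
    have hW := hfence t (by rwa [hτ]) hgt.ne' t (t₀ + h) (η t) hgt.le le_rfl hsol (by
      rw [hτ]
      calc _ = ‖(η t t - η t₀ t₀ - (t - t₀) • (δ t₀ + G t₀ t₀ (η t₀ t₀))) +
              -(η t₀ t - η t₀ t₀ - (t - t₀) • G t₀ t₀ (η t₀ t₀)) +
              -((t - t₀) • (δ t - δ t₀))‖ := by congr 1; module
        _ ≤ ε / 3 * (t - t₀) + ε / 3 * (t - t₀) + (t - t₀) * (ε / 3) := by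
            refine norm_add₃_le.trans ?_
            rw [norm_neg, norm_neg]
            gcongr
        _ = _ := by ring) (t₀ + h) ⟨by linarith, le_rfl⟩
    rw [hτ] at hW
    have hclose : ‖η t (t₀ + h) - η t₀ (t₀ + h)‖ < ρ₂ := by
      calc _ = ‖(η t (t₀ + h) - η t₀ (t₀ + h) - (t - t₀) • δ (t₀ + h)) +
              (t - t₀) • δ (t₀ + h)‖ := by congr 1; abel
        _ ≤ C * ε * (t - t₀) + (t - t₀) * ‖δ (t₀ + h)‖ := by
            refine (norm_add_le _ _).trans ?_
            rw [norm_smul, Real.norm_eq_abs, hτ]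
            gcongr
        _ < ρ₂ := by nlinarith
    have hB := hshort₂ t (by rwa [hτ]) (t₀ + h) (t + h) (η t) (by linarith) (by simpa)
      (by rw [add_sub_add_right_eq_sub, hτ]; exact h₂) hclose
      fun r hr => (hη t htS r ⟨by linarith [hr.1], hr.2⟩).mono
        (Icc_subset_Icc (by linarith) le_rfl)
    calc _ = ‖(η t (t₀ + h) - η t₀ (t₀ + h) - (t - t₀) • δ (t₀ + h)) +
            (η t (t + h) - η t (t₀ + h) -
              (t + h - (t₀ + h)) • G t₀ (t₀ + h) (η t₀ (t₀ + h)))‖ := by congr 1; module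
      _ ≤ C * ε * (t - t₀) + ε * (t + h - (t₀ + h)) := (norm_add_le _ _).trans (add_le_add hW hB)
      _ ≤ c * (t - t₀) := by rw [← hεc]; nlinarith

end ParametricFlow

section ParametricIntegral

variable {H E : Type*} [NormedAddCommGroup H] [NormedSpace ℝ H]
  [NormedAddCommGroup E] [NormedSpace ℝ E]

/-- Differentiation under the integral sign over a compact interval, for an integrand that is
`C¹` in the parameter, jointly with the variable of integration. -/
lemma hasFDerivAt_intervalIntegral_of_continuous {F : H → ℝ → E} {F' : H → ℝ → H →L[ℝ] E}
    (hF : ∀ z, Continuous (F z)) (hF' : Continuous fun p : H × ℝ => F' p.1 p.2) {a b : ℝ}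
    (hd : ∀ z θ, HasFDerivAt (fun z => F z θ) (F' z θ) z) (z : H) :
    HasFDerivAt (fun z => ∫ θ in a..b, F z θ) (∫ θ in a..b, F' z θ) z := by
  have hF'z : Continuous (F' z) := hF'.comp (f := fun θ => (z, θ)) (by fun_prop)
  have hbound : ∀ᶠ w in 𝓝 z, ∀ θ ∈ uIcc a b, ‖F' w θ‖ < ‖F' z θ‖ + 1 := by
    refine isCompact_uIcc.eventually_forall_of_forall_eventually fun θ _ => ?_
    have h1 : Continuous fun p : H × ℝ => ‖F' p.1 p.2‖ := hF'.norm
    have h2 : Continuous fun p : H × ℝ => ‖F' z p.2‖ + 1 := by fun_prop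
    exact h1.continuousAt.eventually_lt h2.continuousAt (lt_add_one _)
  refine intervalIntegral.hasFDerivAt_integral_of_dominated_of_fderiv_le
    (bound := fun θ => ‖F' z θ‖ + 1) hbound
    (Eventually.of_forall fun w => (hF w).aestronglyMeasurable)
    ((hF z).intervalIntegrable _ _) hF'z.aestronglyMeasurable
    (Eventually.of_forall fun θ hθ w hw => (hw θ (uIoc_subset_uIcc hθ)).le)
    ((hF'z.norm.add continuous_const).intervalIntegrable _ _)
    (Eventually.of_forall fun θ _ w _ => hd w θ)

end ParametricIntegral

lemma continuous_clamp_comp {X Y : Type*} [TopologicalSpace X] [TopologicalSpace Y] {h : ℝ}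
    (hh : 0 ≤ h) {Φ : ℝ → X → Y}
    (hΦ : ContinuousOn (fun p : ℝ × X => Φ p.1 p.2) (Icc (-h) 0 ×ˢ univ)) :
    Continuous fun p : ℝ × X => Φ (max (-h) (min p.1 0)) p.2 :=
  hΦ.comp_continuous (f := fun p : ℝ × X => (max (-h) (min p.1 0), p.2)) (by fun_prop)
    fun _ => ⟨⟨le_max_left _ _, max_le (by linarith) (min_le_right _ _)⟩, mem_univ _⟩

lemma HasDerivWithinAt.comp_sub_Icc {F : Type*} [NormedAddCommGroup F] [NormedSpace ℝ F]
    {g : ℝ → F} {g' : F} {h t r : ℝ} (hg : HasDerivWithinAt g g' (Icc 0 h) (r - t)) :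
    HasDerivWithinAt (fun r => g (r - t)) g' (Icc t (t + h)) r := by
  have hmaps : MapsTo (fun r => r - t) (Icc t (t + h)) (Icc 0 h) := fun s hs =>
    ⟨by linarith [hs.1], by linarith [hs.2]⟩
  exact (hg.scomp r (((hasDerivAt_id r).sub_const t).hasDerivWithinAt) hmaps).congr_deriv
    (by simp)

/-- **Theorem 1 (predictor-transformed system).**
For the control-affine system with distributed input delay
`ẋ(t) = f(x(t)) + B₀(x(t))u(t) + B₁(x(t))u(t-h) + ∫_{-h}^0 B_int(θ, x(t)) u(t+θ) dθ`,
let `ξ(t,·)` solve the prediction ODE with zero future input started at `x(t)`, and let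
`β(t,·)` solve the linear matrix ODE `β' = Ã β + B_int(-s, ξ)` with `β(t,0) = B₀(x(t))`,
where `Ã(t,s) = A(ξ) + Σᵢ 𝓑₁ⁱ(ξ)uᵢ(t+s-h) + Σᵢ ∫_{-h}^{-s} 𝓑_intⁱ(θ,ξ)uᵢ(t+s+θ)dθ`
(here the sums over columns are expressed through the full Fréchet derivatives
`DB₁`, `DB_int` via `flip`).  Then `y(t) := ξ(t,h)` is differentiable on `[0,∞)` and
`ẏ(t) = f(y(t)) + (B₁(y(t)) + β(t,h)) u(t)`. -/
theorem predictor_transformed_system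
    (n m : ℕ) (hn : 0 < n) (hm : 0 < m)
    (h : ℝ) (hh : 0 < h)
    -- the open-loop vector field and its Jacobian
    (f : EuclideanSpace ℝ (Fin n) → EuclideanSpace ℝ (Fin n))
    (A : EuclideanSpace ℝ (Fin n) → (EuclideanSpace ℝ (Fin n) →L[ℝ] EuclideanSpace ℝ (Fin n)))
    (hf : ∀ z, HasFDerivAt f (A z) z) (hA_cont : Continuous A)
    -- the input matrices
    (B0 B1 : EuclideanSpace ℝ (Fin n) →
      (EuclideanSpace ℝ (Fin m) →L[ℝ] EuclideanSpace ℝ (Fin n)))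
    (hB0_cont : Continuous B0)
    (DB1 : EuclideanSpace ℝ (Fin n) →
      (EuclideanSpace ℝ (Fin n) →L[ℝ] (EuclideanSpace ℝ (Fin m) →L[ℝ] EuclideanSpace ℝ (Fin n))))
    (hB1 : ∀ z, HasFDerivAt B1 (DB1 z) z) (hDB1_cont : Continuous DB1)
    (Bint : ℝ → EuclideanSpace ℝ (Fin n) →
      (EuclideanSpace ℝ (Fin m) →L[ℝ] EuclideanSpace ℝ (Fin n)))
    (hBint_cont : ContinuousOn (fun p : ℝ × EuclideanSpace ℝ (Fin n) => Bint p.1 p.2)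
      (Icc (-h) 0 ×ˢ univ))
    (DBint : ℝ → EuclideanSpace ℝ (Fin n) →
      (EuclideanSpace ℝ (Fin n) →L[ℝ] (EuclideanSpace ℝ (Fin m) →L[ℝ] EuclideanSpace ℝ (Fin n))))
    (hBint : ∀ θ ∈ Icc (-h) 0, ∀ z, HasFDerivAt (Bint θ) (DBint θ z) z)
    (hDBint_cont : ContinuousOn (fun p : ℝ × EuclideanSpace ℝ (Fin n) => DBint p.1 p.2)
      (Icc (-h) 0 ×ˢ univ))
    -- the input signal and the solution of the plant
    (u : ℝ → EuclideanSpace ℝ (Fin m)) (hu_cont : Continuous u)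
    (x : ℝ → EuclideanSpace ℝ (Fin n))
    (hx : ∀ t : ℝ, 0 ≤ t → HasDerivWithinAt x
      (f (x t) + (B0 (x t)) (u t) + (B1 (x t)) (u (t - h)) +
        ∫ θ in (-h)..0, (Bint θ (x t)) (u (t + θ))) (Ici 0) t)
    (hxC1 : ContDiffOn ℝ 1 x (Ici 0))
    -- the prediction trajectories ξ(t,·)
    (ξ : ℝ → ℝ → EuclideanSpace ℝ (Fin n))
    (hξ0 : ∀ t : ℝ, 0 ≤ t → ξ t 0 = x t)
    (hξC1 : ∀ t : ℝ, 0 ≤ t → ContDiffOn ℝ 1 (ξ t) (Icc 0 h))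
    (hξ : ∀ t : ℝ, 0 ≤ t → ∀ s ∈ Icc 0 h, HasDerivWithinAt (ξ t)
      (f (ξ t s) + (B1 (ξ t s)) (u (t + s - h)) +
        ∫ θ in (-h)..(-s), (Bint θ (ξ t s)) (u (t + s + θ))) (Icc 0 h) s)
    -- the matrix trajectories β(t,·)
    (β : ℝ → ℝ → (EuclideanSpace ℝ (Fin m) →L[ℝ] EuclideanSpace ℝ (Fin n)))
    (hβ0 : ∀ t : ℝ, 0 ≤ t → β t 0 = B0 (x t))
    (hβC1 : ∀ t : ℝ, 0 ≤ t → ContDiffOn ℝ 1 (β t) (Icc 0 h))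
    (hβ : ∀ t : ℝ, 0 ≤ t → ∀ s ∈ Icc 0 h, HasDerivWithinAt (β t)
      ((A (ξ t s) + (DB1 (ξ t s)).flip (u (t + s - h)) +
          ∫ θ in (-h)..(-s), (DBint θ (ξ t s)).flip (u (t + s + θ))).comp (β t s) +
        Bint (-s) (ξ t s)) (Icc 0 h) s) :
    -- conclusion: y(t) = ξ(t,h) satisfies ẏ = f(y) + (B₁(y) + β(t,h)) u(t)
    ∀ t : ℝ, 0 ≤ t → HasDerivWithinAt (fun τ => ξ τ h)
      (f (ξ t h) + (B1 (ξ t h) + β t h) (u t)) (Ici 0) t := by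
  intro t₀ ht₀
  set κ : ℝ → ℝ := fun θ => max (-h) (min θ 0) with hκ
  have hκ_mem : ∀ θ, κ θ ∈ Icc (-h) 0 := fun θ =>
    ⟨le_max_left _ _, max_le (by linarith) (min_le_right _ _)⟩
  have hκ_self : ∀ θ ∈ Icc (-h) 0, κ θ = θ := fun θ hθ => by
    simp only [hκ, min_eq_left hθ.2, max_eq_right hθ.1]
  have hκ_cont : Continuous κ := by fun_prop
  have hBc : Continuous fun p : ℝ × EuclideanSpace ℝ (Fin n) => Bint (κ p.1) p.2 :=
    continuous_clamp_comp hh.le hBint_cont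
  have hDBc : Continuous fun p : ℝ × EuclideanSpace ℝ (Fin n) => DBint (κ p.1) p.2 :=
    continuous_clamp_comp hh.le hDBint_cont
  have hfc : Continuous f := continuous_iff_continuousAt.2 fun z => (hf z).continuousAt
  have hB1c : Continuous B1 := continuous_iff_continuousAt.2 fun z => (hB1 z).continuousAt
  have hflip : Continuous fun L : EuclideanSpace ℝ (Fin n) →L[ℝ]
      (EuclideanSpace ℝ (Fin m) →L[ℝ] EuclideanSpace ℝ (Fin n)) => L.flip :=
    (ContinuousLinearMap.flipₗᵢ ℝ _ _ _).continuous
  have hint_cont : ∀ {r : ℝ} {z : EuclideanSpace ℝ (Fin n)},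
      Continuous fun θ => (Bint (κ θ) z) (u (r + θ)) := fun {r z} =>
    (hBc.comp (f := fun θ => (θ, z)) (by fun_prop)).clm_apply (by fun_prop)
  -- In terms of absolute time `r = t + s` the prediction vector field is `C¹` in `(t, z)`.
  set G : ℝ → ℝ → EuclideanSpace ℝ (Fin n) → EuclideanSpace ℝ (Fin n) := fun t r z =>
    f z + (B1 z) (u (r - h)) + ∫ θ in (-h)..(t - r), (Bint (κ θ) z) (u (r + θ)) with hG
  set Gt : ℝ → ℝ → EuclideanSpace ℝ (Fin n) → EuclideanSpace ℝ (Fin n) := fun t r z =>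
    (Bint (κ (t - r)) z) (u t) with hGt
  set Gz : ℝ → ℝ → EuclideanSpace ℝ (Fin n) →
      EuclideanSpace ℝ (Fin n) →L[ℝ] EuclideanSpace ℝ (Fin n) := fun t r z =>
    A z + (DB1 z).flip (u (r - h)) +
      ∫ θ in (-h)..(t - r), (DBint (κ θ) z).flip (u (r + θ)) with hGz
  have hG_eq : ∀ t r z, r ∈ Icc t (t + h) → G t r z =
      f z + (B1 z) (u (r - h)) + ∫ θ in (-h)..(t - r), (Bint θ z) (u (r + θ)) := by
    intro t r z hr
    simp only [hG]
    congr 1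
    refine intervalIntegral.integral_congr fun θ hθ => ?_
    rw [uIcc_of_le (by linarith [hr.2])] at hθ
    simp only [hκ_self θ ⟨hθ.1, by linarith [hθ.2, hr.1]⟩]
  have hGz_eq : ∀ t r z, r ∈ Icc t (t + h) → Gz t r z =
      A z + (DB1 z).flip (u (r - h)) +
        ∫ θ in (-h)..(t - r), (DBint θ z).flip (u (r + θ)) := by
    intro t r z hr
    simp only [hGz]
    congr 1
    refine intervalIntegral.integral_congr fun θ hθ => ?_
    rw [uIcc_of_le (by linarith [hr.2])] at hθ
    simp only [hκ_self θ ⟨hθ.1, by linarith [hθ.2, hr.1]⟩]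
  have hG_cont : Continuous fun p : ℝ × ℝ × EuclideanSpace ℝ (Fin n) => G p.1 p.2.1 p.2.2 := by
    refine Continuous.add (by fun_prop)
      (intervalIntegral.continuous_parametric_intervalIntegral_of_continuous ?_ (by fun_prop))
    exact (hBc.comp (f := fun q : (ℝ × ℝ × EuclideanSpace ℝ (Fin n)) × ℝ => (q.2, q.1.2.2))
      (by fun_prop)).clm_apply (by fun_prop)
  have hGz_cont : Continuous fun p : ℝ × ℝ × EuclideanSpace ℝ (Fin n) => Gz p.1 p.2.1 p.2.2 := by
    refine Continuous.add ?_
      (intervalIntegral.continuous_parametric_intervalIntegral_of_continuous ?_ (by fun_prop))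
    · exact (hA_cont.comp (by fun_prop)).add
        ((hflip.comp (hDB1_cont.comp (by fun_prop))).clm_apply (by fun_prop))
    · exact (hflip.comp (hDBc.comp
        (f := fun q : (ℝ × ℝ × EuclideanSpace ℝ (Fin n)) × ℝ => (q.2, q.1.2.2))
        (by fun_prop))).clm_apply (by fun_prop)
  have hGt_cont : Continuous fun p : ℝ × ℝ × EuclideanSpace ℝ (Fin n) => Gt p.1 p.2.1 p.2.2 :=
    (hBc.comp (f := fun q : ℝ × ℝ × EuclideanSpace ℝ (Fin n) => (q.1 - q.2.1, q.2.2))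
      (by fun_prop)).clm_apply (by fun_prop)
  have hGt_deriv : ∀ t r z, HasDerivAt (fun τ => G τ r z) (Gt t r z) t := by
    intro t r z
    have := ((hint_cont (r := r) (z := z)).integral_hasStrictDerivAt (-h) (t - r)).hasDerivAt
    have := (this.comp_sub_const t r).const_add (f z + (B1 z) (u (r - h)))
    rwa [add_sub_cancel] at this
  have hGz_deriv : ∀ t r z, HasFDerivAt (G t r) (Gz t r z) z := by
    intro t r z
    refine ((hf z).add ?_).add (hasFDerivAt_intervalIntegral_of_continuous
      (F := fun z θ => (Bint (κ θ) z) (u (r + θ)))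
      (F' := fun z θ => (DBint (κ θ) z).flip (u (r + θ))) (fun _ => hint_cont) ?_ ?_ z)
    · refine ((hB1 z).clm_apply (hasFDerivAt_const (u (r - h)) z)).congr_fderiv ?_
      simp
    · exact (hflip.comp (hDBc.comp (f := fun q : EuclideanSpace ℝ (Fin n) × ℝ => (q.2, q.1))
        (by fun_prop))).clm_apply (by fun_prop)
    · intro z θ
      refine ((hBint (κ θ) (hκ_mem θ) z).clm_apply
        (hasFDerivAt_const (u (r + θ)) z)).congr_fderiv ?_
      simp
  have hmem : ∀ {t r : ℝ}, r ∈ Icc t (t + h) → r - t ∈ Icc 0 h := fun hr =>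
    ⟨by linarith [hr.1], by linarith [hr.2]⟩
  have hη : ∀ t ∈ Ici (0 : ℝ), ∀ r ∈ Icc t (t + h), HasDerivWithinAt (fun r => ξ t (r - t))
      (G t r (ξ t (r - t))) (Icc t (t + h)) r := by
    intro t ht r hr
    have := hξ t ht (r - t) (hmem hr)
    rw [add_sub_cancel, neg_sub] at this
    rw [hG_eq t r _ hr]
    exact this.comp_sub_Icc
  have hδ : ∀ r ∈ Icc t₀ (t₀ + h), HasDerivWithinAt (fun r => (β t₀ (r - t₀)) (u t₀))
      (Gz t₀ r (ξ t₀ (r - t₀)) ((β t₀ (r - t₀)) (u t₀)) + Gt t₀ r (ξ t₀ (r - t₀)))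
      (Icc t₀ (t₀ + h)) r := by
    intro r hr
    have := hβ t₀ ht₀ (r - t₀) (hmem hr)
    rw [add_sub_cancel, neg_sub] at this
    rw [hGz_eq t₀ r _ hr]
    refine (this.comp_sub_Icc.clm_apply (hasDerivWithinAt_const r _ (u t₀))).congr_deriv ?_
    have hκr : κ (t₀ - r) = t₀ - r :=
      hκ_self _ (mem_Icc.2 ⟨by linarith [hr.2], by linarith [hr.1]⟩)
    simp only [hGt, hκr]
    simp
  have hend := hasDerivWithinAt_moving_endpoint hG_cont hGt_deriv hGz_deriv hGt_cont hGz_cont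
    hh hη ht₀ hδ ?_
  · refine (hend.congr_deriv ?_).congr (fun t _ => by simp) (by simp)
    rw [hG_eq _ _ _ ⟨by linarith, le_rfl⟩]
    simp
    abel
  · simp only [sub_self]
    refine ((hx t₀ ht₀).congr (fun t ht => hξ0 t ht) (hξ0 t₀ ht₀)).congr_deriv ?_
    rw [hG_eq _ _ _ ⟨le_rfl, by linarith⟩, hβ0 t₀ ht₀, hξ0 t₀ ht₀, sub_self]
    abel
end

section
/- Let h > 0, and let M_κ > 0, m_{w₀} > 0, M_{v₀} > 0 be constants. Let Y : [0,∞) → ℝⁿ be continuous, let u : [-h,∞) → ℝᵐ be continuous with ‖u(t)‖ ≤ M_κ‖Y(t)‖ for all t ≥ 0, and let v₀ : ℝⁿ → ℝ satisfy v₀(y) ≤ M_{v₀}‖y‖² for all y ∈ ℝⁿ. Suppose the function g(t) := v₀(Y(t)) is differentiable on (0,∞) with g'(t) ≤ -m_{w₀}‖Y(t)‖² for all t > 0. Set γ = m_{w₀}/(2M_κ²) and σ = m_{w₀}/(2M_{v₀}), and define the Lyapunov–Krasovskii functional along the trajectory by v(t) = g(t) + γ∫_{-h}^0 e^{σθ}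 ‖u(t+θ)‖² dθ. Then v is differentiable on (0,∞) and v'(t) ≤ -σ v(t) for all t > 0. -/
open Real Set

/-- Leibniz rule for the exponentially weighted integral over a moving window. -/
theorem hasDerivAt_integral_exp_mul_comp_add {f : ℝ → ℝ} (hf : Continuous f) (h σ t : ℝ) :
    HasDerivAt (fun τ => ∫ θ in (-h)..0, Real.exp (σ * θ) * f (τ + θ))
      (f t - Real.exp (-(σ * h)) * f (t - h) -
        σ * ∫ θ in (-h)..0, Real.exp (σ * θ) * f (t + θ)) t := by
  have hF : Continuous fun s => Real.exp (σ * s) * f s := by fun_prop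
  have hshift : ∀ τ, ∫ θ in (-h)..0, Real.exp (σ * θ) * f (τ + θ) =
      Real.exp (-(σ * τ)) * ((∫ s in (0 : ℝ)..τ, Real.exp (σ * s) * f s) -
        ∫ s in (0 : ℝ)..(τ - h), Real.exp (σ * s) * f s) := by
    intro τ
    rw [intervalIntegral.integral_interval_sub_left (hF.intervalIntegrable _ _)
      (hF.intervalIntegrable _ _), ← intervalIntegral.integral_const_mul]
    have key := intervalIntegral.integral_comp_add_left (a := -h) (b := 0)
      (fun s => Real.exp (-(σ * τ)) * (Real.exp (σ * s) * f s)) τ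
    rw [add_zero, ← sub_eq_add_neg] at key
    rw [← key]
    refine intervalIntegral.integral_congr fun θ _ => ?_
    rw [← mul_assoc, ← Real.exp_add]
    congr 2
    ring
  have hprim : ∀ x, HasDerivAt (fun τ => ∫ s in (0 : ℝ)..τ, Real.exp (σ * s) * f s)
      (Real.exp (σ * x) * f x) x := fun x => hF.integral_hasStrictDerivAt 0 x |>.hasDerivAt
  have hexp : HasDerivAt (fun τ => Real.exp (-(σ * τ))) (Real.exp (-(σ * t)) * -(σ * 1)) t :=
    (((hasDerivAt_id t).const_mul σ).neg).exp
  rw [hshift t]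
  simp only [hshift]
  refine (hexp.mul ((hprim t).sub ((hprim (t - h)).comp_sub_const t h))).congr_deriv ?_
  have h₁ : Real.exp (-(σ * t)) * Real.exp (σ * t) = 1 := by
    rw [← Real.exp_add, neg_add_cancel, Real.exp_zero]
  have h₂ : Real.exp (-(σ * h)) = Real.exp (-(σ * t)) * Real.exp (σ * (t - h)) := by
    rw [← Real.exp_add]
    congr 1
    ring
  rw [h₂, Pi.sub_apply]
  linear_combination f t * h₁

/-- The Leibniz rule of `hasDerivAt_integral_exp_mul_comp_add` for a function that is only
continuous on `[-h, ∞)`, at positive times. -/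
theorem ContinuousOn.hasDerivAt_integral_exp_mul_comp_add {f : ℝ → ℝ} {h t : ℝ}
    (hf : ContinuousOn f (Ici (-h))) (hh : 0 ≤ h) (ht : 0 < t) (σ : ℝ) :
    HasDerivAt (fun τ => ∫ θ in (-h)..0, Real.exp (σ * θ) * f (τ + θ))
      (f t - Real.exp (-(σ * h)) * f (t - h) -
        σ * ∫ θ in (-h)..0, Real.exp (σ * θ) * f (t + θ)) t := by
  have hcont : Continuous fun s => f (max s (-h)) :=
    hf.comp_continuous (by fun_prop) fun s => le_max_right s (-h)
  have hint : ∀ τ, 0 < τ → ∫ θ in (-h)..0, Real.exp (σ * θ) * f (τ + θ) =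
      ∫ θ in (-h)..0, Real.exp (σ * θ) * f (max (τ + θ) (-h)) := by
    intro τ hτ
    refine intervalIntegral.integral_congr fun θ hθ => ?_
    rw [uIcc_of_le (by linarith)] at hθ
    rw [max_eq_left (by linarith [hθ.1])]
  have key := _root_.hasDerivAt_integral_exp_mul_comp_add hcont h σ t
  rw [max_eq_left (by linarith), max_eq_left (by linarith), ← hint t ht] at key
  refine key.congr_of_eventuallyEq ?_
  filter_upwards [Ioi_mem_nhds ht] with τ hτ using hint τ hτ

/-- **Core dissipation inequality (51) in the proof of Theorem 2.**
Along a trajectory with linearly bounded feedback `‖u(t)‖ ≤ M_κ ‖Y(t)‖` and with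
`g(t) = v₀(Y(t))` satisfying `g'(t) ≤ -m_{w₀}‖Y(t)‖²`, the Lyapunov–Krasovskii functional
`v(t) = g(t) + γ ∫_{-h}^0 e^{σθ} ‖u(t+θ)‖² dθ`, `γ = m_{w₀}/(2M_κ²)`, `σ = m_{w₀}/(2M_{v₀})`,
is differentiable on `(0,∞)` and satisfies `v'(t) ≤ -σ v(t)`. -/
theorem lyapunov_krasovskii_dissipation
    (n m : ℕ) (hn : 0 < n) (hm : 0 < m)
    (h Mκ mw0 Mv0 : ℝ) (hh : 0 < h) (hMκ : 0 < Mκ) (hmw0 : 0 < mw0) (hMv0 : 0 < Mv0)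
    (Y : ℝ → EuclideanSpace ℝ (Fin n)) (hY_cont : ContinuousOn Y (Ici 0))
    (u : ℝ → EuclideanSpace ℝ (Fin m)) (hu_cont : ContinuousOn u (Ici (-h)))
    (hu_bound : ∀ t : ℝ, 0 ≤ t → ‖u t‖ ≤ Mκ * ‖Y t‖)
    (v₀ : EuclideanSpace ℝ (Fin n) → ℝ)
    (hv₀ : ∀ y, v₀ y ≤ Mv0 * ‖y‖ ^ 2)
    (g' : ℝ → ℝ)
    (hg : ∀ t : ℝ, 0 < t → HasDerivAt (fun τ => v₀ (Y τ)) (g' t) t)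
    (hg' : ∀ t : ℝ, 0 < t → g' t ≤ -mw0 * ‖Y t‖ ^ 2) :
    ∀ t : ℝ, 0 < t → ∃ d : ℝ,
      HasDerivAt (fun τ => v₀ (Y τ) +
        (mw0 / (2 * Mκ ^ 2)) *
          ∫ θ in (-h)..0, Real.exp ((mw0 / (2 * Mv0)) * θ) * ‖u (τ + θ)‖ ^ 2) d t ∧
      d ≤ -(mw0 / (2 * Mv0)) *
        (v₀ (Y t) +
          (mw0 / (2 * Mκ ^ 2)) *
            ∫ θ in (-h)..0, Real.exp ((mw0 / (2 * Mv0)) * θ) * ‖u (t + θ)‖ ^ 2) := by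
  intro t ht
  refine ⟨_, (hg t ht).add (((hu_cont.norm.pow 2).hasDerivAt_integral_exp_mul_comp_add
    hh.le ht (mw0 / (2 * Mv0))).const_mul (mw0 / (2 * Mκ ^ 2))), ?_⟩
  simp only [Pi.pow_apply]
  have hu : mw0 / (2 * Mκ ^ 2) * ‖u t‖ ^ 2 ≤ mw0 / 2 * ‖Y t‖ ^ 2 :=
    calc mw0 / (2 * Mκ ^ 2) * ‖u t‖ ^ 2
        ≤ mw0 / (2 * Mκ ^ 2) * (Mκ * ‖Y t‖) ^ 2 := by gcongr; exact hu_bound t ht.le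
      _ = mw0 / 2 * ‖Y t‖ ^ 2 := by field_simp
  have hv : mw0 / (2 * Mv0) * v₀ (Y t) ≤ mw0 / 2 * ‖Y t‖ ^ 2 :=
    calc mw0 / (2 * Mv0) * v₀ (Y t)
        ≤ mw0 / (2 * Mv0) * (Mv0 * ‖Y t‖ ^ 2) := by gcongr; exact hv₀ _
      _ = mw0 / 2 * ‖Y t‖ ^ 2 := by field_simp
  have hdelay : 0 ≤ mw0 / (2 * Mκ ^ 2) *
      (Real.exp (-(mw0 / (2 * Mv0) * h)) * ‖u (t - h)‖ ^ 2) := by positivity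
  linarith [hg' t ht]
end

section
/- Let h > 0, ρ ≥ 1, and let m_{v₀} > 0, M_{v₀} > 0, γ > 0, σ > 0 be constants. Let x ∈ ℝⁿ, Y ∈ ℝⁿ, and let φ : [-h,0] → ℝᵐ be continuous with ‖φ‖² = ∫_{-h}^0 ‖φ(θ)‖² dθ. Assume ‖x‖² ≤ ρ²(‖Y‖² + ‖φ‖²) and ‖Y‖² ≤ ρ²(‖x‖² + ‖φ‖²), and let v₀ : ℝⁿ → ℝ satisfy m_{v₀}‖y‖² ≤ v₀(y) ≤ M_{v₀}‖y‖² for all y ∈ ℝⁿ. Define v = v₀(Y) + γ∫_{-h}^0 e^{σθ}‖φ(θ)‖² dθ. Then m_v(‖x‖² + ‖φ‖²) ≤ v ≤ M_v(‖x‖² + ‖φ‖²), where m_v = (1/(2ρ²))·min{m_{v₀}, γe^{-σh}, ρ²γe^{-σh}} and M_v = γ + ρ²M_{v₀}. -/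
open Real Set

/-- An exponential weight `e^{σθ}` on `[-h, 0]` changes the integral of a nonnegative function by a
factor between `e^{-σh}` and `1`. -/
theorem exp_weighted_integral_bounds {h σ : ℝ} (hh : 0 ≤ h) (hσ : 0 ≤ σ) {f : ℝ → ℝ}
    (hf : Continuous f) (hf0 : ∀ θ, 0 ≤ f θ) :
    Real.exp (-σ * h) * (∫ θ in (-h)..0, f θ) ≤ ∫ θ in (-h)..0, Real.exp (σ * θ) * f θ ∧
      ∫ θ in (-h)..0, Real.exp (σ * θ) * f θ ≤ ∫ θ in (-h)..0, f θ := by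
  have hw : Continuous fun θ => Real.exp (σ * θ) * f θ := by fun_prop
  constructor
  · rw [← intervalIntegral.integral_const_mul]
    refine intervalIntegral.integral_mono_on (by linarith)
      ((hf.const_mul _).intervalIntegrable _ _) (hw.intervalIntegrable _ _) fun θ hθ => ?_
    refine mul_le_mul_of_nonneg_right (Real.exp_le_exp.2 ?_) (hf0 θ)
    nlinarith [hθ.1]
  · refine intervalIntegral.integral_mono_on (by linarith)
      (hw.intervalIntegrable _ _) (hf.intervalIntegrable _ _) fun θ hθ => ?_
    exact mul_le_of_le_one_left (hf0 θ)
      (Real.exp_le_one_iff.2 (mul_nonpos_of_nonneg_of_nonpos hσ hθ.2))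

/-- **Quadratic sandwich estimate (49) for the Lyapunov–Krasovskii functional.**
If `‖x‖² ≤ ρ²(‖Y‖² + ‖φ‖²)` and `‖Y‖² ≤ ρ²(‖x‖² + ‖φ‖²)` with `ρ ≥ 1`, and
`m_{v₀}‖y‖² ≤ v₀(y) ≤ M_{v₀}‖y‖²`, then the functional
`v = v₀(Y) + γ ∫_{-h}^0 e^{σθ}‖φ(θ)‖² dθ` satisfies
`m_v(‖x‖² + ‖φ‖²) ≤ v ≤ M_v(‖x‖² + ‖φ‖²)` with
`m_v = (1/(2ρ²)) min{m_{v₀}, γ e^{-σh}, ρ² γ e^{-σh}}` and `M_v = γ + ρ² M_{v₀}`. -/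
theorem lyapunov_krasovskii_sandwich
    (n m : ℕ) (hn : 0 < n) (hm : 0 < m)
    (h ρ mv0 Mv0 γ σ : ℝ)
    (hh : 0 < h) (hρ : 1 ≤ ρ) (hmv0 : 0 < mv0) (hMv0 : 0 < Mv0) (hγ : 0 < γ) (hσ : 0 < σ)
    (x Y : EuclideanSpace ℝ (Fin n))
    (φ : ℝ → EuclideanSpace ℝ (Fin m)) (hφ_cont : Continuous φ)
    (hxY : ‖x‖ ^ 2 ≤ ρ ^ 2 * (‖Y‖ ^ 2 + ∫ θ in (-h)..0, ‖φ θ‖ ^ 2))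
    (hYx : ‖Y‖ ^ 2 ≤ ρ ^ 2 * (‖x‖ ^ 2 + ∫ θ in (-h)..0, ‖φ θ‖ ^ 2))
    (v₀ : EuclideanSpace ℝ (Fin n) → ℝ)
    (hv₀ : ∀ y, mv0 * ‖y‖ ^ 2 ≤ v₀ y ∧ v₀ y ≤ Mv0 * ‖y‖ ^ 2) :
    (1 / (2 * ρ ^ 2)) * min (min mv0 (γ * Real.exp (-σ * h))) (ρ ^ 2 * (γ * Real.exp (-σ * h))) *
        (‖x‖ ^ 2 + ∫ θ in (-h)..0, ‖φ θ‖ ^ 2) ≤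
      v₀ Y + γ * ∫ θ in (-h)..0, Real.exp (σ * θ) * ‖φ θ‖ ^ 2 ∧
    v₀ Y + γ * ∫ θ in (-h)..0, Real.exp (σ * θ) * ‖φ θ‖ ^ 2 ≤
      (γ + ρ ^ 2 * Mv0) * (‖x‖ ^ 2 + ∫ θ in (-h)..0, ‖φ θ‖ ^ 2) := by
  have hI : 0 ≤ ∫ θ in (-h)..0, ‖φ θ‖ ^ 2 :=
    intervalIntegral.integral_nonneg (by linarith) fun θ _ => sq_nonneg _
  obtain ⟨hlow, hupp⟩ := exp_weighted_integral_bounds hh.le hσ.le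
    (f := fun θ => ‖φ θ‖ ^ 2) (by fun_prop) fun θ => sq_nonneg _
  obtain ⟨hv_low, hv_upp⟩ := hv₀ Y
  generalize (∫ θ in (-h)..0, ‖φ θ‖ ^ 2) = I at *
  generalize (∫ θ in (-h)..0, Real.exp (σ * θ) * ‖φ θ‖ ^ 2) = J at *
  have hρ2 : 1 ≤ ρ ^ 2 := one_le_pow₀ hρ
  have hγlow := mul_le_mul_of_nonneg_left hlow hγ.le
  have hγupp := mul_le_mul_of_nonneg_left hupp hγ.le
  constructor
  · set μ := min (min mv0 (γ * Real.exp (-σ * h))) (ρ ^ 2 * (γ * Real.exp (-σ * h)))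
    have hμ0 : 0 ≤ μ := by positivity
    have hμm : μ ≤ mv0 := (min_le_left _ _).trans (min_le_left _ _)
    have hμE : μ ≤ γ * Real.exp (-σ * h) := (min_le_left _ _).trans (min_le_right _ _)
    have hsum : ‖x‖ ^ 2 + I ≤ 2 * ρ ^ 2 * (‖Y‖ ^ 2 + I) := by
      nlinarith [mul_nonneg (sub_nonneg.2 hρ2) hI, mul_nonneg (sq_nonneg ρ) (sq_nonneg ‖Y‖)]
    calc 1 / (2 * ρ ^ 2) * μ * (‖x‖ ^ 2 + I)
        ≤ 1 / (2 * ρ ^ 2) * μ * (2 * ρ ^ 2 * (‖Y‖ ^ 2 + I)) := by gcongr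
      _ = μ * ‖Y‖ ^ 2 + μ * I := by field_simp
      _ ≤ mv0 * ‖Y‖ ^ 2 + γ * Real.exp (-σ * h) * I := by gcongr
      _ ≤ v₀ Y + γ * J := by linarith
  · have hY := mul_le_mul_of_nonneg_left hYx hMv0.le
    linarith [mul_nonneg hγ.le (sq_nonneg ‖x‖)]
end

section
/- Let h > 0, let u : ℝ → ℝ be continuous, and let x₁, x₂ : ℝ → ℝ be differentiable functions satisfying ẋ₁(t) = x₂(t)² + u(t-h) and ẋ₂(t) = x₂(t) + u(t) for all t ∈ ℝ. Define y₁(t) = x₁(t) + ((e^{2h}-1)/2)·x₂(t)² + ∫_{t-h}^t u(θ) dθ and y₂(t) = e^h x₂(t). Then y₁ and y₂ are differentiable and satisfy ẏ₁(t) = y₂(t)² + (1 + (e^h - e^{-h}) y₂(t)) u(t) and ẏ₂(t) = y₂(t) + e^h u(t) for all t ∈ ℝ. -/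
open Real Set

theorem hasDerivAt_integral_sub_const {u : ℝ → ℝ} (hu : Continuous u) (h t : ℝ) :
    HasDerivAt (fun τ => ∫ θ in (τ - h)..τ, u θ) (u t - u (t - h)) t := by
  have hF (s : ℝ) : HasDerivAt (fun τ => ∫ θ in (0 : ℝ)..τ, u θ) (u s) s :=
    hu.integral_hasStrictDerivAt 0 s |>.hasDerivAt
  have key := (hF t).sub ((hF (t - h)).comp_sub_const t h)
  refine key.congr_of_eventuallyEq (.of_forall fun τ => ?_)
  exact (intervalIntegral.integral_interval_sub_left (hu.intervalIntegrable _ _)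
    (hu.intervalIntegrable _ _)).symm

/-- **Explicit predictor transformation of Section V-B.**
For the system `ẋ₁ = x₂² + u(t-h)`, `ẋ₂ = x₂ + u(t)`, the transformation
`y₁ = x₁ + ((e^{2h}-1)/2)x₂² + ∫_{t-h}^t u`, `y₂ = e^h x₂` gives the delay-free system
`ẏ₁ = y₂² + (1 + (e^h - e^{-h})y₂)u`, `ẏ₂ = y₂ + e^h u`. -/
theorem explicit_predictor_transformation
    (h : ℝ) (hh : 0 < h)
    (u x₁ x₂ : ℝ → ℝ) (hu_cont : Continuous u)
    (hx₁ : ∀ t : ℝ, HasDerivAt x₁ (x₂ t ^ 2 + u (t - h)) t)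
    (hx₂ : ∀ t : ℝ, HasDerivAt x₂ (x₂ t + u t) t) :
    ∀ t : ℝ,
      HasDerivAt (fun τ => x₁ τ + ((Real.exp (2 * h) - 1) / 2) * x₂ τ ^ 2 +
          ∫ θ in (τ - h)..τ, u θ)
        ((Real.exp h * x₂ t) ^ 2 +
          (1 + (Real.exp h - Real.exp (-h)) * (Real.exp h * x₂ t)) * u t) t ∧
      HasDerivAt (fun τ => Real.exp h * x₂ τ)
        (Real.exp h * x₂ t + Real.exp h * u t) t := by
  intro t
  refine ⟨?_, ?_⟩
  · refine (((hx₁ t).add (((hx₂ t).pow 2).const_mul ((Real.exp (2 * h) - 1) / 2))).add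
      (hasDerivAt_integral_sub_const hu_cont h t)).congr_deriv ?_
    have hsq : Real.exp (2 * h) = Real.exp h ^ 2 := by rw [two_mul, Real.exp_add, sq]
    have hinv : Real.exp (-h) * Real.exp h = 1 := by rw [← Real.exp_add]; simp
    rw [hsq]
    push_cast
    linear_combination (x₂ t * u t) * hinv
  · rw [← mul_add]
    exact (hx₂ t).const_mul _
end

section
/- Let h > 0, let u, ũ : ℝ → ℝ be continuous, and let y₁, y₂ : ℝ → ℝ be differentiable functions satisfying ẏ₁(t) = y₂(t)² + (1 + (e^h - e^{-h}) y₂(t)) u(t) and ẏ₂(t) = y₂(t) + e^h u(t) for all t. Define z₁(t) = y₁(t) - e^{-h} y₂(t) + ((e^{-2h}-1)/2)·y₂(t)² and z₂(t) = e^{-h} y₂(t), and suppose u(t) = -2 z₂(t) + ũ(t) for all t. Then ż₁(t) = z₂(t)² - z₂(t) and ż₂(t) = -z₂(t) + ũ(t) for all t ∈ ℝ. -/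
open Real Set

/-- **Second transformation of Section V-B.**
The state and input transformation `z₁ = y₁ - e^{-h}y₂ + ((e^{-2h}-1)/2)y₂²`,
`z₂ = e^{-h}y₂`, `u = -2z₂ + ũ` puts the predictor-transformed system
`ẏ₁ = y₂² + (1 + (e^h - e^{-h})y₂)u`, `ẏ₂ = y₂ + e^h u` into the cascade form
`ż₁ = z₂² - z₂`, `ż₂ = -z₂ + ũ`. -/
theorem cascade_transformation
    (h : ℝ) (hh : 0 < h)
    (u utilde y₁ y₂ : ℝ → ℝ) (hu_cont : Continuous u) (hutilde_cont : Continuous utilde)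
    (hy₁ : ∀ t : ℝ, HasDerivAt y₁
      (y₂ t ^ 2 + (1 + (Real.exp h - Real.exp (-h)) * y₂ t) * u t) t)
    (hy₂ : ∀ t : ℝ, HasDerivAt y₂ (y₂ t + Real.exp h * u t) t)
    (hfeed : ∀ t : ℝ, u t = -2 * (Real.exp (-h) * y₂ t) + utilde t) :
    ∀ t : ℝ,
      HasDerivAt (fun τ => y₁ τ - Real.exp (-h) * y₂ τ +
          ((Real.exp (-2 * h) - 1) / 2) * y₂ τ ^ 2)
        ((Real.exp (-h) * y₂ t) ^ 2 - Real.exp (-h) * y₂ t) t ∧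
      HasDerivAt (fun τ => Real.exp (-h) * y₂ τ)
        (-(Real.exp (-h) * y₂ t) + utilde t) t := by
  intro t
  have hinv : Real.exp (-h) * Real.exp h = 1 := by
    rw [← Real.exp_add, neg_add_cancel, Real.exp_zero]
  have hsq : Real.exp (-2 * h) = Real.exp (-h) ^ 2 := by
    rw [← Real.exp_nat_mul]
    congr 1
    push_cast
    ring
  have hz₂ := (hy₂ t).const_mul (Real.exp (-h))
  constructor
  · refine (((hy₁ t).sub hz₂).add
      (((hy₂ t).pow 2).const_mul ((Real.exp (-2 * h) - 1) / 2))).congr_deriv ?_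
    rw [hsq]
    push_cast
    linear_combination (-u t + Real.exp (-h) * y₂ t * u t) * hinv
  · refine hz₂.congr_deriv ?_
    linear_combination u t * hinv + hfeed t
end

section
/- Let ũ : ℝ → ℝ be continuous and let z₁, z₂ : ℝ → ℝ be differentiable functions satisfying ż₁(t) = z₂(t)² - z₂(t) and ż₂(t) = -z₂(t) + ũ(t) for all t. Define V(t) = (z₁(t) + (1/2)z₂(t)(z₂(t)-2))² + z₂(t)². Then V is differentiable and for all t ∈ ℝ, V̇(t) = -2 z₂(t)² + [2(z₁(t) + (1/2)z₂(t)(z₂(t)-2))(z₂(t)-1) + 2z₂(t)]·ũ(t). Moreover, the function V(z₁,z₂) = (z₁ + (1/2)z₂(z₂-2))² + z₂² on ℝ² is positive definite: V(0,0) = 0 and V(z₁,z₂) > 0 for (z₁,z₂) ≠ (0,0). -/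
open Real Set

/-- **Lyapunov computation of Section V-B.**
Along solutions of the cascade system `ż₁ = z₂² - z₂`, `ż₂ = -z₂ + ũ`, the function
`V(t) = (z₁ + ½z₂(z₂-2))² + z₂²` is differentiable with
`V̇ = -2z₂² + [2(z₁ + ½z₂(z₂-2))(z₂-1) + 2z₂]ũ`; moreover `(z₁,z₂) ↦ (z₁ + ½z₂(z₂-2))² + z₂²`
is positive definite on `ℝ²`. -/
theorem cascade_lyapunov
    (utilde z₁ z₂ : ℝ → ℝ) (hutilde_cont : Continuous utilde)
    (hz₁ : ∀ t : ℝ, HasDerivAt z₁ (z₂ t ^ 2 - z₂ t) t)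
    (hz₂ : ∀ t : ℝ, HasDerivAt z₂ (-z₂ t + utilde t) t) :
    (∀ t : ℝ,
      HasDerivAt (fun τ => (z₁ τ + (1 / 2) * z₂ τ * (z₂ τ - 2)) ^ 2 + z₂ τ ^ 2)
        (-2 * z₂ t ^ 2 +
          (2 * (z₁ t + (1 / 2) * z₂ t * (z₂ t - 2)) * (z₂ t - 1) + 2 * z₂ t) * utilde t) t) ∧
    ((fun p : ℝ × ℝ => (p.1 + (1 / 2) * p.2 * (p.2 - 2)) ^ 2 + p.2 ^ 2) (0, 0) = 0 ∧
      ∀ p : ℝ × ℝ, p ≠ (0, 0) →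
        0 < (p.1 + (1 / 2) * p.2 * (p.2 - 2)) ^ 2 + p.2 ^ 2) := by
  refine ⟨fun t => ?_, by norm_num, ?_⟩
  · have h := ((((hz₁ t).add (((hz₂ t).const_mul (1 / 2)).mul ((hz₂ t).sub_const 2))).pow 2).add
      ((hz₂ t).pow 2))
    refine h.congr_deriv ?_
    simp only [Pi.add_apply, Pi.mul_apply]
    push_cast
    ring
  · rintro ⟨x, y⟩ hp
    dsimp only
    rcases eq_or_ne y 0 with rfl | hy
    · have hx : x ≠ 0 := fun hx => hp (by rw [hx])
      have : 0 < x ^ 2 := by positivity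
      simpa using this
    · positivity
end

section
/- Let h > 0, let ũ : ℝ → ℝ be continuous, let x₁, x₂ : ℝ → ℝ be differentiable, and let u : ℝ → ℝ satisfy u(t) = -2x₂(t) + ũ(t) for all t. Suppose ẋ₁(t) = x₂(t)² + u(t-h) and ẋ₂(t) = x₂(t) + u(t) for all t ∈ ℝ. Define z₁(t) = x₁(t) - x₂(t) + ∫_{t-h}^t u(θ) dθ and z₂(t) = x₂(t). Then ż₁(t) = z₂(t)² - z₂(t) and ż₂(t) = -z₂(t) + ũ(t) for all t ∈ ℝ. -/
open Real Set

/-- The derivative of the integral of a continuous function over a sliding window `[t - h, t]`. -/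
theorem hasDerivAt_integral_sliding_window {f : ℝ → ℝ} (hf : Continuous f) (h t : ℝ) :
    HasDerivAt (fun τ => ∫ θ in (τ - h)..τ, f θ) (f t - f (t - h)) t := by
  have hprim (s : ℝ) : HasDerivAt (fun τ => ∫ θ in (0 : ℝ)..τ, f θ) (f s) s :=
    intervalIntegral.integral_hasDerivAt_right (hf.intervalIntegrable _ _)
      (hf.stronglyMeasurableAtFilter _ _) hf.continuousAt
  have hsplit : (fun τ => ∫ θ in (τ - h)..τ, f θ) =
      fun τ => (∫ θ in (0 : ℝ)..τ, f θ) - ∫ θ in (0 : ℝ)..(τ - h), f θ := by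
    funext τ
    exact (intervalIntegral.integral_interval_sub_left (hf.intervalIntegrable _ _)
      (hf.intervalIntegrable _ _)).symm
  rw [hsplit]
  exact (hprim t).sub ((hprim (t - h)).comp_sub_const t h)

/-- **Overall linear transformation of Section V-B.**
For `ẋ₁ = x₂² + u(t-h)`, `ẋ₂ = x₂ + u(t)` with `u = -2x₂ + ũ`, the transformation
`z₁ = x₁ - x₂ + ∫_{t-h}^t u`, `z₂ = x₂` yields the cascade form
`ż₁ = z₂² - z₂`, `ż₂ = -z₂ + ũ`. -/
theorem overall_linear_transformation
    (h : ℝ) (hh : 0 < h)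
    (utilde u x₁ x₂ : ℝ → ℝ) (hutilde_cont : Continuous utilde)
    (hfeed : ∀ t : ℝ, u t = -2 * x₂ t + utilde t)
    (hx₁ : ∀ t : ℝ, HasDerivAt x₁ (x₂ t ^ 2 + u (t - h)) t)
    (hx₂ : ∀ t : ℝ, HasDerivAt x₂ (x₂ t + u t) t) :
    ∀ t : ℝ,
      HasDerivAt (fun τ => x₁ τ - x₂ τ + ∫ θ in (τ - h)..τ, u θ)
        (x₂ t ^ 2 - x₂ t) t ∧
      HasDerivAt x₂ (-x₂ t + utilde t) t := by
  have hx₂_cont : Continuous x₂ :=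
    continuous_iff_continuousAt.2 fun t => (hx₂ t).continuousAt
  have hu : Continuous u := by
    rw [funext hfeed]
    fun_prop
  intro t
  constructor
  · exact (((hx₁ t).sub (hx₂ t)).add
      (hasDerivAt_integral_sliding_window hu h t)).congr_deriv (by ring)
  · exact (hx₂ t).congr_deriv (by rw [hfeed]; ring)
end

section
/- Let a : [0, π/2) → ℝ be continuous with |a(s)| ≤ 1 for all s, and let β₁, β₂ : [0, π/2) → ℝ be C¹ functions satisfying β₁'(s) = β₂(s), β₂'(s) = a(s)β₁(s), β₁(0) = 0, β₂(0) = 1. Then for every s ∈ [0, π/2): β₂(s) > 0, β₁(s) ≥ 0, and tanh(s) ≤ β₁(s)/β₂(s) ≤ tan(s). -/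
open Real Set

/-- A solution of `β₁' = β₂`, `β₂' = a β₁` with `-1 ≤ a` and `β₁ ≥ 0` satisfies the Sturm comparison
with `sin` and `cos`. -/
lemma mul_cos_le_mul_sin_of_hasDerivWithinAt {a β₁ β₂ : ℝ → ℝ} {t : ℝ} (ht0 : 0 ≤ t) (htπ : t ≤ π)
    (ha : ∀ s ∈ Icc 0 t, -1 ≤ a s)
    (hβ₁ : ∀ s ∈ Icc 0 t, HasDerivWithinAt β₁ (β₂ s) (Icc 0 t) s)
    (hβ₂ : ∀ s ∈ Icc 0 t, HasDerivWithinAt β₂ (a s * β₁ s) (Icc 0 t) s)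
    (h10 : β₁ 0 = 0) (hnonneg : ∀ s ∈ Icc 0 t, 0 ≤ β₁ s) :
    β₁ t * cos t ≤ β₂ t * sin t := by
  have hderiv : ∀ s ∈ Icc 0 t, HasDerivWithinAt (fun s => β₂ s * sin s - β₁ s * cos s)
      ((a s + 1) * β₁ s * sin s) (Icc 0 t) s := fun s hs =>
    ((hβ₂ s hs).mul (hasDerivAt_sin s).hasDerivWithinAt).sub
      ((hβ₁ s hs).mul (hasDerivAt_cos s).hasDerivWithinAt) |>.congr_deriv (by ring)
  have hmono := monotoneOn_of_hasDerivWithinAt_nonneg (convex_Icc 0 t)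
    (fun s hs => (hderiv s hs).continuousWithinAt)
    (fun s hs => (hderiv s (interior_subset hs)).mono interior_subset) (fun s hs => by
      have hs := interior_subset hs
      exact mul_nonneg (mul_nonneg (by linarith [ha s hs]) (hnonneg s hs))
        (sin_nonneg_of_nonneg_of_le_pi hs.1 (hs.2.trans htπ)))
  have h := hmono (left_mem_Icc.2 ht0) (right_mem_Icc.2 ht0) ht0
  simp only [sin_zero, h10] at h
  linarith

/-- A solution of `β₁' = β₂`, `β₂' = a β₁` with `a ≤ 1` and `β₁ ≥ 0` satisfies the Sturm comparison
with `sinh` and `cosh`. -/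
lemma mul_sinh_le_mul_cosh_of_hasDerivWithinAt {a β₁ β₂ : ℝ → ℝ} {t : ℝ} (ht0 : 0 ≤ t)
    (ha : ∀ s ∈ Icc 0 t, a s ≤ 1)
    (hβ₁ : ∀ s ∈ Icc 0 t, HasDerivWithinAt β₁ (β₂ s) (Icc 0 t) s)
    (hβ₂ : ∀ s ∈ Icc 0 t, HasDerivWithinAt β₂ (a s * β₁ s) (Icc 0 t) s)
    (h10 : β₁ 0 = 0) (hnonneg : ∀ s ∈ Icc 0 t, 0 ≤ β₁ s) :
    β₂ t * sinh t ≤ β₁ t * cosh t := by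
  have hderiv : ∀ s ∈ Icc 0 t, HasDerivWithinAt (fun s => β₁ s * cosh s - β₂ s * sinh s)
      ((1 - a s) * β₁ s * sinh s) (Icc 0 t) s := fun s hs =>
    ((hβ₁ s hs).mul (hasDerivAt_cosh s).hasDerivWithinAt).sub
      ((hβ₂ s hs).mul (hasDerivAt_sinh s).hasDerivWithinAt) |>.congr_deriv (by ring)
  have hmono := monotoneOn_of_hasDerivWithinAt_nonneg (convex_Icc 0 t)
    (fun s hs => (hderiv s hs).continuousWithinAt)
    (fun s hs => (hderiv s (interior_subset hs)).mono interior_subset) (fun s hs => by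
      have hs := interior_subset hs
      exact mul_nonneg (mul_nonneg (by linarith [ha s hs]) (hnonneg s hs))
        (sinh_nonneg_iff.2 hs.1))
  have h := hmono (left_mem_Icc.2 ht0) (right_mem_Icc.2 ht0) ht0
  simp only [sinh_zero, h10] at h
  linarith

/-- A function whose derivative is positive on `[0, t)` is strictly increasing on `[0, t]`. -/
lemma strictMonoOn_Icc_of_hasDerivWithinAt_pos {f f' : ℝ → ℝ} {t : ℝ}
    (hf : ∀ s ∈ Icc 0 t, HasDerivWithinAt f (f' s) (Icc 0 t) s)
    (hpos : ∀ s ∈ Ico 0 t, 0 < f' s) : StrictMonoOn f (Icc 0 t) :=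
  strictMonoOn_of_hasDerivWithinAt_pos (convex_Icc 0 t)
    (fun s hs => (hf s hs).continuousWithinAt)
    (fun s hs => (hf s (interior_subset hs)).mono interior_subset)
    (fun s hs => by
      rw [interior_Icc] at hs
      exact hpos s ⟨hs.1.le, hs.2⟩)

/-- **Ratio bounds for the pendulum matrix ODE (Section V-C).**
If `β₁' = β₂`, `β₂' = a β₁` on `[0, π/2)` with `|a| ≤ 1`, `β₁(0) = 0`, `β₂(0) = 1`, then
`β₂ > 0`, `β₁ ≥ 0` and `tanh s ≤ β₁(s)/β₂(s) ≤ tan s` on `[0, π/2)`. -/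
theorem beta_ratio_bounds
    (a β₁ β₂ : ℝ → ℝ)
    (ha_cont : ContinuousOn a (Ico 0 (π / 2)))
    (ha : ∀ s ∈ Ico (0 : ℝ) (π / 2), |a s| ≤ 1)
    (hβ₁ : ∀ s ∈ Ico (0 : ℝ) (π / 2), HasDerivWithinAt β₁ (β₂ s) (Ico 0 (π / 2)) s)
    (hβ₂ : ∀ s ∈ Ico (0 : ℝ) (π / 2), HasDerivWithinAt β₂ (a s * β₁ s) (Ico 0 (π / 2)) s)
    (hβ₁C1 : ContDiffOn ℝ 1 β₁ (Ico 0 (π / 2)))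
    (hβ₂C1 : ContDiffOn ℝ 1 β₂ (Ico 0 (π / 2)))
    (h10 : β₁ 0 = 0) (h20 : β₂ 0 = 1) :
    ∀ s ∈ Ico (0 : ℝ) (π / 2),
      0 < β₂ s ∧ 0 ≤ β₁ s ∧
      Real.tanh s ≤ β₁ s / β₂ s ∧ β₁ s / β₂ s ≤ Real.tan s := by
  have hsub : ∀ t ∈ Ico (0 : ℝ) (π / 2), Icc 0 t ⊆ Ico 0 (π / 2) :=
    fun t ht s hs => ⟨hs.1, hs.2.trans_lt ht.2⟩
  have hd₁ : ∀ t ∈ Ico (0 : ℝ) (π / 2), ∀ s ∈ Icc 0 t, HasDerivWithinAt β₁ (β₂ s) (Icc 0 t) s :=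
    fun t ht s hs => (hβ₁ s (hsub t ht hs)).mono (hsub t ht)
  have hd₂ : ∀ t ∈ Ico (0 : ℝ) (π / 2), ∀ s ∈ Icc 0 t,
      HasDerivWithinAt β₂ (a s * β₁ s) (Icc 0 t) s :=
    fun t ht s hs => (hβ₂ s (hsub t ht hs)).mono (hsub t ht)
  have hnonneg : ∀ t ∈ Ico (0 : ℝ) (π / 2), (∀ s ∈ Ico 0 t, 0 < β₂ s) →
      ∀ s ∈ Icc 0 t, 0 ≤ β₁ s := fun t ht hpos s hs => by
    rw [← h10]
    exact (strictMonoOn_Icc_of_hasDerivWithinAt_pos (hd₁ t ht) hpos).monotoneOn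
      (left_mem_Icc.2 ht.1) hs hs.1
  have hsin : ∀ t ∈ Ico (0 : ℝ) (π / 2), (∀ s ∈ Ico 0 t, 0 < β₂ s) →
      β₁ t * cos t ≤ β₂ t * sin t := fun t ht hpos =>
    mul_cos_le_mul_sin_of_hasDerivWithinAt ht.1 (by linarith [ht.2, pi_pos])
      (fun s hs => (abs_le.1 (ha s (hsub t ht hs))).1) (hd₁ t ht) (hd₂ t ht) h10
      (hnonneg t ht hpos)
  have hpos : ∀ s ∈ Ico (0 : ℝ) (π / 2), 0 < β₂ s := by
    intro T hT
    by_contra! hneg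
    have hcont : ContinuousOn β₂ (Icc 0 T) := fun s hs => (hd₂ T hT s hs).continuousWithinAt
    have hcompact : IsCompact (Icc 0 T ∩ β₂ ⁻¹' Iic 0) :=
      isCompact_Icc.of_isClosed_subset (hcont.preimage_isClosed_of_isClosed isClosed_Icc isClosed_Iic)
        inter_subset_left
    obtain ⟨t, ⟨htT, ht⟩, hleast⟩ :=
      hcompact.exists_isLeast ⟨T, right_mem_Icc.2 hT.1, hneg⟩
    have htI := hsub T hT htT
    have hbefore : ∀ s ∈ Ico 0 t, 0 < β₂ s := fun s hs => by
      by_contra! h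
      exact hs.2.not_ge (hleast ⟨⟨hs.1, hs.2.le.trans htT.2⟩, h⟩)
    have ht0 : 0 < t := htT.1.lt_of_ne fun h => by
      rw [← h, mem_preimage, h20, mem_Iic] at ht
      linarith
    have hβ₁t : 0 < β₁ t := by
      rw [← h10]
      exact strictMonoOn_Icc_of_hasDerivWithinAt_pos (hd₁ t htI) hbefore
        (left_mem_Icc.2 ht0.le) (right_mem_Icc.2 ht0.le) ht0
    have hcos : 0 < cos t := cos_pos_of_mem_Ioo ⟨by linarith [pi_pos], htI.2⟩
    have hsint : 0 ≤ sin t := sin_nonneg_of_nonneg_of_le_pi ht0.le (by linarith [htI.2, pi_pos])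
    exact absurd (hsin t htI hbefore)
      ((mul_nonpos_of_nonpos_of_nonneg ht hsint).trans_lt (mul_pos hβ₁t hcos)).not_ge
  intro t ht
  have hbefore : ∀ s ∈ Ico 0 t, 0 < β₂ s := fun s hs => hpos s ⟨hs.1, hs.2.trans ht.2⟩
  have hcos : 0 < cos t := cos_pos_of_mem_Ioo ⟨by linarith [ht.1, pi_pos], ht.2⟩
  refine ⟨hpos t ht, hnonneg t ht hbefore t (right_mem_Icc.2 ht.1), ?_, ?_⟩
  · rw [tanh_eq_sinh_div_cosh, div_le_div_iff₀ (cosh_pos t) (hpos t ht), mul_comm]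
    exact mul_sinh_le_mul_cosh_of_hasDerivWithinAt ht.1
      (fun s hs => (abs_le.1 (ha s (hsub t ht hs))).2) (hd₁ t ht) (hd₂ t ht) h10
      (hnonneg t ht hbefore)
  · rw [tan_eq_sin_div_cos, div_le_div_iff₀ (hpos t ht) hcos, mul_comm (sin t)]
    exact hsin t ht hbefore
end

section
/- Let a : [0, π/2) → ℝ be continuous with |a(s)| ≤ 1 for all s, and let β₁, β₂ : [0, π/2) → ℝ be C¹ functions satisfying β₁'(s) = β₂(s), β₂'(s) = a(s)β₁(s), β₁(0) = 0, β₂(0) = 1. Then for every s ∈ [0, π/2): 1 ≤ β₁(s)² + β₂(s)² ≤ e^{2s}. -/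
open Real Set

/-- A function on `[0, T)` with nonnegative derivative is bounded below by its value at `0`. -/
lemma le_of_hasDerivWithinAt_Ico_nonneg {T : ℝ} {f f' : ℝ → ℝ}
    (hf : ∀ s ∈ Ico 0 T, HasDerivWithinAt f (f' s) (Ico 0 T) s)
    (hf' : ∀ s ∈ Ico 0 T, 0 ≤ f' s) {s : ℝ} (hs : s ∈ Ico 0 T) : f 0 ≤ f s := by
  have hmono : MonotoneOn f (Ico 0 T) :=
    monotoneOn_of_hasDerivWithinAt_nonneg (convex_Ico 0 T)
      (fun x hx => (hf x hx).continuousWithinAt)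
      (fun x hx => (hf x (interior_subset hx)).mono interior_subset)
      (fun x hx => hf' x (interior_subset hx))
  exact hmono ⟨le_rfl, hs.1.trans_lt hs.2⟩ hs hs.1

/-- **Norm bounds for the pendulum matrix ODE (Section V-C).**
If `β₁' = β₂`, `β₂' = a β₁` on `[0, π/2)` with `|a| ≤ 1`, `β₁(0) = 0`, `β₂(0) = 1`, then
`1 ≤ β₁(s)² + β₂(s)² ≤ e^{2s}` on `[0, π/2)`. -/
theorem beta_norm_bounds
    (a β₁ β₂ : ℝ → ℝ)
    (ha_cont : ContinuousOn a (Ico 0 (π / 2)))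
    (ha : ∀ s ∈ Ico (0 : ℝ) (π / 2), |a s| ≤ 1)
    (hβ₁ : ∀ s ∈ Ico (0 : ℝ) (π / 2), HasDerivWithinAt β₁ (β₂ s) (Ico 0 (π / 2)) s)
    (hβ₂ : ∀ s ∈ Ico (0 : ℝ) (π / 2), HasDerivWithinAt β₂ (a s * β₁ s) (Ico 0 (π / 2)) s)
    (hβ₁C1 : ContDiffOn ℝ 1 β₁ (Ico 0 (π / 2)))
    (hβ₂C1 : ContDiffOn ℝ 1 β₂ (Ico 0 (π / 2)))
    (h10 : β₁ 0 = 0) (h20 : β₂ 0 = 1) :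
    ∀ s ∈ Ico (0 : ℝ) (π / 2),
      1 ≤ β₁ s ^ 2 + β₂ s ^ 2 ∧ β₁ s ^ 2 + β₂ s ^ 2 ≤ Real.exp (2 * s) := by
  have hcos : ∀ s ∈ Ico (0 : ℝ) (π / 2), 0 < cos s := fun s hs =>
    cos_pos_of_mem_Ioo ⟨by linarith [hs.1, pi_pos], hs.2⟩
  -- The component of `(β₁, β₂)` along the reference solution `(sin, cos)` for `a = -1`.
  set p : ℝ → ℝ := fun s => β₂ s * cos s + β₁ s * sin s with hp
  have hp' : ∀ s ∈ Ico (0 : ℝ) (π / 2),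
      HasDerivWithinAt p ((1 + a s) * β₁ s * cos s) (Ico 0 (π / 2)) s := fun s hs =>
    (((hβ₂ s hs).mul (hasDerivAt_cos s).hasDerivWithinAt).add
      ((hβ₁ s hs).mul (hasDerivAt_sin s).hasDerivWithinAt)).congr_deriv (by ring)
  have hr' : ∀ s ∈ Ico (0 : ℝ) (π / 2),
      HasDerivWithinAt (fun s => β₁ s / cos s) (p s / cos s ^ 2) (Ico 0 (π / 2)) s := fun s hs =>
    ((hβ₁ s hs).div (hasDerivAt_cos s).hasDerivWithinAt (hcos s hs).ne').congr_deriv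
      (by simp only [hp]; ring)
  have hrp : ∀ s ∈ Ico (0 : ℝ) (π / 2), 0 ≤ β₁ s * p s := by
    intro s hs
    have h := le_of_hasDerivWithinAt_Ico_nonneg (fun t ht => (hr' t ht).mul (hp' t ht))
      (fun t ht => by
        have hc := hcos t ht
        have ha' : 0 ≤ 1 + a t := by linarith [(abs_le.mp (ha t ht)).1]
        have h₁ : 0 ≤ p t / cos t ^ 2 * p t := by
          rw [div_mul_eq_mul_div]; exact div_nonneg (mul_self_nonneg _) (sq_nonneg _)
        have h₂ : β₁ t / cos t * ((1 + a t) * β₁ t * cos t) = (1 + a t) * β₁ t ^ 2 := by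
          field_simp
        rw [h₂]
        positivity) hs
    simp only [Pi.mul_apply, h10, zero_div, zero_mul] at h
    rw [div_mul_eq_mul_div] at h
    simpa [(hcos s hs).ne'] using mul_nonneg h (hcos s hs).le
  intro s hs
  constructor
  · have h := le_of_hasDerivWithinAt_Ico_nonneg (fun t ht => (hp' t ht).pow 2)
      (fun t ht => by
        have ha' : 0 ≤ 1 + a t := by linarith [(abs_le.mp (ha t ht)).1]
        have := mul_nonneg (mul_nonneg ha' (hcos t ht).le) (hrp t ht)
        norm_num
        nlinarith) hs
    have hp0 : p 0 = 1 := by simp [hp, h20]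
    simp only [Pi.pow_apply, hp0, one_pow] at h
    have hN : β₁ s ^ 2 + β₂ s ^ 2 = p s ^ 2 + (β₁ s * cos s - β₂ s * sin s) ^ 2 := by
      simp only [hp]
      linear_combination (-(β₁ s ^ 2 + β₂ s ^ 2)) * sin_sq_add_cos_sq s
    rw [hN]
    linarith [sq_nonneg (β₁ s * cos s - β₂ s * sin s)]
  · have hN : ∀ t ∈ Ico (0 : ℝ) (π / 2),
        HasDerivWithinAt (fun t => -((β₁ t ^ 2 + β₂ t ^ 2) * exp (-(2 * t))))
          ((2 * (β₁ t ^ 2 + β₂ t ^ 2) - 2 * (1 + a t) * (β₁ t * β₂ t)) * exp (-(2 * t)))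
          (Ico 0 (π / 2)) t := fun t ht =>
      ((((hβ₁ t ht).pow 2).add ((hβ₂ t ht).pow 2)).mul
        (((hasDerivAt_id t).const_mul 2).neg.exp.hasDerivWithinAt)).neg.congr_deriv
        (by simp; ring)
    have h := le_of_hasDerivWithinAt_Ico_nonneg hN
      (fun t ht => by
        obtain ⟨h₁, h₂⟩ := abs_le.mp (ha t ht)
        refine mul_nonneg ?_ (exp_pos _).le
        nlinarith [mul_nonneg (by linarith : 0 ≤ 1 + a t) (sq_nonneg (β₁ t - β₂ t)),
          mul_nonneg (by linarith : 0 ≤ 1 - a t) (add_nonneg (sq_nonneg (β₁ t)) (sq_nonneg (β₂ t)))])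
      hs
    simp only [h10, h20, mul_zero, neg_zero, exp_zero, exp_neg, ← div_eq_mul_inv] at h
    rw [← div_le_one (exp_pos _)]
    linarith
end

section
/- Let α ∈ [-0.22, 1] and let b₁, b₂ ∈ ℝ satisfy b₂ > 0, tanh(π/4) ≤ b₁/b₂ ≤ 1, and 1 ≤ b₁² + b₂² ≤ e^{π/2}. Set F = [[0, 1], [α, 0]] and B = (b₁, 1 + b₂)ᵀ ∈ ℝ². Then the symmetric 2×2 matrix M = Fᵀ + F - 4BBᵀ, i.e. M = [[-4b₁², 1 + α - 4b₁(1+b₂)], [1 + α - 4b₁(1+b₂), -4(1+b₂)²]], is negative definite: vᵀMv < 0 for every nonzero v ∈ ℝ². -/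
open Real Matrix

/-- A real symmetric `2 × 2` matrix with negative top-left entry and positive determinant is
negative definite. -/
lemma dotProduct_mulVec_neg_of_det_pos {a b d : ℝ} (ha : a < 0) (hdet : 0 < a * d - b ^ 2)
    {v : Fin 2 → ℝ} (hv : v ≠ 0) : v ⬝ᵥ (!![a, b; b, d]).mulVec v < 0 := by
  have hform : v ⬝ᵥ (!![a, b; b, d]).mulVec v = a * v 0 ^ 2 + 2 * b * v 0 * v 1 + d * v 1 ^ 2 := by
    simp [Matrix.mulVec, dotProduct, Fin.sum_univ_two]
    ring
  rw [hform]
  have key : 0 < a * (a * v 0 ^ 2 + 2 * b * v 0 * v 1 + d * v 1 ^ 2) := by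
    have hsq : a * (a * v 0 ^ 2 + 2 * b * v 0 * v 1 + d * v 1 ^ 2) =
        (a * v 0 + b * v 1) ^ 2 + (a * d - b ^ 2) * v 1 ^ 2 := by ring
    rw [hsq]
    by_cases h1 : v 1 = 0
    · have h0 : v 0 ≠ 0 := by
        intro h0
        apply hv
        ext i
        fin_cases i <;> simp [h0, h1]
      have : a * v 0 ≠ 0 := mul_ne_zero ha.ne h0
      rw [h1]
      simp only [mul_zero, add_zero, ne_eq, OfNat.ofNat_ne_zero, not_false_eq_true, zero_pow]
      positivity
    · positivity
  exact neg_of_mul_pos_right key ha.le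

lemma one_third_le_tanh_pi_div_four : 1 / 3 ≤ Real.tanh (π / 4) := by
  have hexp : 2 ≤ Real.exp (π / 4) * Real.exp (π / 4) := by
    rw [← Real.exp_add]
    linarith [Real.add_one_le_exp (π / 4 + π / 4), Real.pi_gt_three]
  have hinv : Real.exp (π / 4) * Real.exp (-(π / 4)) = 1 := by
    rw [← Real.exp_add, add_neg_cancel, Real.exp_zero]
  have hpos := Real.exp_pos (π / 4)
  rw [Real.tanh_eq_sinh_div_cosh, le_div_iff₀ (Real.cosh_pos _), Real.sinh_eq, Real.cosh_eq]
  nlinarith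

/-- **Negative definiteness check of Section V-C (pendulum, `h = π/4`).**
For `α ∈ [-0.22, 1]`, `b₂ > 0`, `tanh(π/4) ≤ b₁/b₂ ≤ 1`, `1 ≤ b₁² + b₂² ≤ e^{π/2}`,
with `F = [[0,1],[α,0]]` and `B = (b₁, 1 + b₂)ᵀ`, the matrix `M = Fᵀ + F - 4BBᵀ`,
i.e. `M = [[-4b₁², 1+α-4b₁(1+b₂)],[1+α-4b₁(1+b₂), -4(1+b₂)²]]`, is negative definite. -/
theorem pendulum_matrix_negative_definite
    (α b₁ b₂ : ℝ)
    (hα : α ∈ Set.Icc (-0.22 : ℝ) 1)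
    (hb₂ : 0 < b₂)
    (hratio_lo : Real.tanh (π / 4) ≤ b₁ / b₂) (hratio_hi : b₁ / b₂ ≤ 1)
    (hnorm_lo : 1 ≤ b₁ ^ 2 + b₂ ^ 2) (hnorm_hi : b₁ ^ 2 + b₂ ^ 2 ≤ Real.exp (π / 2)) :
    ∀ v : Fin 2 → ℝ, v ≠ 0 →
      v ⬝ᵥ (!![-4 * b₁ ^ 2, 1 + α - 4 * b₁ * (1 + b₂);
               1 + α - 4 * b₁ * (1 + b₂), -4 * (1 + b₂) ^ 2]).mulVec v < 0 := by
  have hlo : 1 / 3 * b₂ ≤ b₁ :=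
    (le_div_iff₀ hb₂).1 (one_third_le_tanh_pi_div_four.trans hratio_lo)
  have hhi : b₁ ≤ b₂ := (div_le_one hb₂).1 hratio_hi
  have hb₁ : 0 < b₁ := by linarith
  have hb₂_lo : 7 / 10 ≤ b₂ := by nlinarith
  have hprod : 1 / 4 < b₁ * (1 + b₂) := by nlinarith
  obtain ⟨hα₁, hα₂⟩ := hα
  have hs : 0 < 1 + α := by norm_num at hα₁; linarith
  intro v hv
  refine dotProduct_mulVec_neg_of_det_pos (by nlinarith) ?_ hv
  have hdet : -4 * b₁ ^ 2 * (-4 * (1 + b₂) ^ 2) - (1 + α - 4 * b₁ * (1 + b₂)) ^ 2 =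
      (1 + α) * (8 * (b₁ * (1 + b₂)) - (1 + α)) := by ring
  rw [hdet]
  exact mul_pos hs (by linarith)
end
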